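/- arXiv:2108.06864 — 2 statements merged into one kernel-verified Lean document; each statement's English description precedes it below -/
import Mathlib

section
/- The quotient ring 𝔯_h = ℤ[x_{ij}^{(k)}]/𝔯[h+1], where 𝔯[h+1] is the ideal generated by all (h+1)-minors det(x_{u_i v_j}^{(0)}) together with all their normalized derivatives ∂̄^n of these minors, is an integral domain. -/
open MvPolynomial

/-- `𝔯 = ℤ[x_{ij}^{(k)}]`. -/
abbrev PolyR (p q : ℕ) := MvPolynomial (Fin p × Fin q × ℕ) ℤ

/-- The derivation `∂` on `𝔯` with `∂x_{ij}^{(k)} = (k+1)x_{ij}^{(k+1)}`. -/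
noncomputable def derivR (p q : ℕ) : Derivation ℤ (PolyR p q) (PolyR p q) :=
  mkDerivation ℤ fun v => ((v.2.2 : ℤ) + 1) • X (v.1, v.2.1, v.2.2 + 1)

/-- The ideal `𝔯[m]` generated by all `m`-minors of `(x_{ij}^{(0)})` together with
all their normalized derivatives `∂̄^n` (characterized by `n! • g = ∂^n B`). -/
noncomputable def minorIdeal (p q m : ℕ) : Ideal (PolyR p q) :=
  Ideal.span {g | ∃ (n : ℕ) (u : Fin m → Fin p) (v : Fin m → Fin q),
    StrictMono u ∧ StrictMono v ∧
    (n.factorial : ℤ) • g =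
      (⇑(derivR p q))^[n]
        (Matrix.det (Matrix.of fun a b : Fin m => (X (u a, v b, 0) : PolyR p q)))}

/-- Dilworth's theorem: a finite set without antichains of more than `n` elements is a union of
`n` chains. -/
theorem exists_chain_coloring {α : Type*} [PartialOrder α] (P : Finset α) (n : ℕ)
    (hP : ∀ B ⊆ P, (∀ x ∈ B, ∀ y ∈ B, x ≤ y → x = y) → B.card ≤ n) :
    ∃ c : α → ℕ, (∀ x ∈ P, c x < n) ∧
      ∀ x ∈ P, ∀ y ∈ P, c x = c y → x ≤ y ∨ y ≤ x := by
  classical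
  induction P using Finset.strongInduction generalizing n with
  | H P ih =>
  rcases P.eq_empty_or_nonempty with rfl | hne
  · exact ⟨fun _ => 0, by simp, by simp⟩
  obtain ⟨a, haP, hamax⟩ := P.exists_maximal hne
  have hn : 1 ≤ n := by
    simpa using hP {a} (by simpa using haP) (by simp)
  have extend : ∀ K ⊆ P, a ∈ K → (∀ x ∈ K, ∀ y ∈ K, x ≤ y ∨ y ≤ x) →
      (∀ B ⊆ P \ K, (∀ x ∈ B, ∀ y ∈ B, x ≤ y → x = y) → B.card ≤ n - 1) →
      ∃ c : α → ℕ, (∀ x ∈ P, c x < n) ∧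
        ∀ x ∈ P, ∀ y ∈ P, c x = c y → x ≤ y ∨ y ≤ x := by
    intro K hKP haK hK hB
    have hss : P \ K ⊂ P :=
      Finset.sdiff_ssubset hKP ⟨a, haK⟩
    obtain ⟨c, hc, hc'⟩ := ih _ hss (n - 1) hB
    refine ⟨fun x => if x ∈ K then n - 1 else c x, fun x hx => ?_, fun x hx y hy hxy => ?_⟩
    · by_cases hxK : x ∈ K
      · simp only [hxK, if_true]; omega
      · have := hc x (by simp [hx, hxK])
        simp only [hxK, if_false]; omega
    · by_cases hxK : x ∈ K <;> by_cases hyK : y ∈ K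
      · exact hK x hxK y hyK
      · have := hc y (by simp [hy, hyK])
        simp only [hxK, hyK, if_true, if_false] at hxy; omega
      · have := hc x (by simp [hx, hxK])
        simp only [hxK, hyK, if_true, if_false] at hxy; omega
      · simp only [hxK, hyK, if_false] at hxy
        exact hc' x (by simp [hx, hxK]) y (by simp [hy, hyK]) hxy
  by_cases hsmall : ∀ B ⊆ P.erase a, (∀ x ∈ B, ∀ y ∈ B, x ≤ y → x = y) → B.card ≤ n - 1
  · refine extend {a} (by simpa using haP) (by simp) (by simp) ?_
    rwa [Finset.sdiff_singleton_eq_erase]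
  push Not at hsmall
  obtain ⟨B₀, hB₀, hB₀anti, hB₀card⟩ := hsmall
  obtain ⟨c, hc, hc'⟩ := ih _ (Finset.erase_ssubset haP) n
    fun B hB => hP B (hB.trans (Finset.erase_subset _ _))
  let full : Finset α → Prop := fun B =>
    B ⊆ P.erase a ∧ (∀ x ∈ B, ∀ y ∈ B, x ≤ y → x = y) ∧ n ≤ B.card
  have hit : ∀ B, full B → ∀ i < n, ∃ b ∈ B, c b = i := by
    intro B ⟨hB, hanti, hcard⟩ i hi
    have hinj : Set.InjOn c B := by
      intro x hx y hy hxy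
      rcases hc' x (hB hx) y (hB hy) hxy with h | h
      · exact hanti x hx y hy h
      · exact (hanti y hy x hx h).symm
    have himg : B.image c = Finset.range n := by
      apply Finset.eq_of_subset_of_card_le
      · intro j hj
        obtain ⟨x, hx, rfl⟩ := Finset.mem_image.1 hj
        exact Finset.mem_range.2 (hc x (hB hx))
      · rw [Finset.card_image_of_injOn hinj, Finset.card_range]; exact hcard
    have : i ∈ B.image c := himg ▸ Finset.mem_range.2 hi
    simpa using this
  have hB₀full : full B₀ := ⟨hB₀, hB₀anti, by omega⟩
  have top : ∀ i < n, ∃ t ∈ P.erase a, c t = i ∧ (∃ B, full B ∧ t ∈ B) ∧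
      ∀ B, full B → ∀ b ∈ B, c b = i → b ≤ t := by
    intro i hi
    obtain ⟨b₀, hb₀, hb₀i⟩ := hit B₀ hB₀full i hi
    obtain ⟨t, ht, htmax⟩ := Finset.exists_maximal
      (s := (P.erase a).filter fun x => c x = i ∧ ∃ B, full B ∧ x ∈ B)
      ⟨b₀, by simp only [Finset.mem_filter]; exact ⟨hB₀ hb₀, hb₀i, B₀, hB₀full, hb₀⟩⟩
    rw [Finset.mem_filter] at ht
    refine ⟨t, ht.1, ht.2.1, ht.2.2, fun B hB b hb hbi => ?_⟩
    rcases hc' b (hB.1 hb) t ht.1 (hbi.trans ht.2.1.symm) with h | h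
    · exact h
    · exact htmax (Finset.mem_filter.2 ⟨hB.1 hb, hbi, B, hB, hb⟩) h
  have : Nonempty α := ⟨a⟩
  choose! t htP htc htfull httop using top
  have htanti : ∀ i < n, ∀ j < n, t i ≤ t j → i = j := by
    intro i hi j hj hij
    obtain ⟨B, hB, htB⟩ := htfull j hj
    obtain ⟨b, hb, hbi⟩ := hit B hB i hi
    have := hB.2.1 b hb (t j) htB ((httop i hi B hB b hb hbi).trans hij)
    rw [← hbi, this, htc j hj]
  have hle : ∃ i < n, t i ≤ a := by
    by_contra! hcon
    have hna : ∀ i < n, ¬ a ≤ t i := fun i hi h =>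
      hcon i hi (hamax (Finset.mem_of_mem_erase (htP i hi)) h)
    have hinj : Set.InjOn t (Finset.range n) := fun i hi j hj hij =>
      htanti i (by simpa using hi) j (by simpa using hj) hij.le
    have hmem : a ∉ (Finset.range n).image t := by
      intro h
      obtain ⟨i, hi, hia⟩ := Finset.mem_image.1 h
      exact hna i (by simpa using hi) hia.ge
    have := hP (insert a ((Finset.range n).image t)) ?_ ?_
    · rw [Finset.card_insert_of_notMem hmem, Finset.card_image_of_injOn hinj,
        Finset.card_range] at this
      omega
    · intro x hx
      rcases Finset.mem_insert.1 hx with rfl | hx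
      · exact haP
      · obtain ⟨i, hi, rfl⟩ := Finset.mem_image.1 hx
        exact Finset.mem_of_mem_erase (htP i (by simpa using hi))
    · intro x hx y hy hxy
      simp only [Finset.mem_insert, Finset.mem_image, Finset.mem_range] at hx hy
      rcases hx with rfl | ⟨i, hi, rfl⟩ <;> rcases hy with rfl | ⟨j, hj, rfl⟩
      · rfl
      · exact absurd hxy (hna j hj)
      · exact absurd hxy (hcon i hi)
      · rw [htanti i hi j hj hxy]
  obtain ⟨i, hi, hia⟩ := hle
  refine extend (insert a ((P.erase a).filter fun x => c x = i ∧ x ≤ t i)) ?_ (by simp) ?_ ?_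
  · intro x hx
    simp only [Finset.mem_insert, Finset.mem_filter, Finset.mem_erase] at hx
    rcases hx with rfl | hx
    · exact haP
    · exact hx.1.2
  · intro x hx y hy
    simp only [Finset.mem_insert, Finset.mem_filter] at hx hy
    rcases hx with rfl | hx <;> rcases hy with rfl | hy
    · exact Or.inl le_rfl
    · exact Or.inr (hy.2.2.trans hia)
    · exact Or.inl (hx.2.2.trans hia)
    · exact hc' x hx.1 y hy.1 (hx.2.1.trans hy.2.1.symm)
  · intro B hB hanti
    by_contra! hcard
    have hBP : B ⊆ P.erase a := by
      intro x hx
      have := hB hx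
      simp only [Finset.mem_sdiff, Finset.mem_insert, not_or] at this
      exact Finset.mem_erase.2 ⟨this.2.1, this.1⟩
    have hBfull : full B := ⟨hBP, hanti, by omega⟩
    obtain ⟨b, hb, hbi⟩ := hit B hBfull i hi
    have := hB hb
    simp only [Finset.mem_sdiff, Finset.mem_insert, Finset.mem_filter, not_or] at this
    exact this.2.2 ⟨hBP hb, hbi, httop i hi B hBfull b hb hbi⟩

/-- Kantorovich potentials: a chain in `ℕ × ℕ` is optimally transported for the cost `W (r + c)`
with `W` convex. -/
theorem exists_potentials (W d : ℕ → ℕ) (hW : ∀ n, W (n + 1) = W n + d n) (hd : Monotone d)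
    (C : Finset (ℕ × ℕ)) (hC : ∀ x ∈ C, ∀ y ∈ C, x ≤ y ∨ y ≤ x) :
    ∃ u w : ℕ → ℕ, (∀ r c, W (r + c) ≤ u r + w c) ∧
      ∀ x ∈ C, W (x.1 + x.2) = u x.1 + w x.2 := by
  classical
  let L := C.sup Prod.fst
  let γ : ℕ → ℕ := fun s => max (C.sup fun x => if x.1 ≤ s then x.2 else 0) (s - L)
  have hγmono : Monotone γ := by
    intro s t hst
    refine max_le_max (Finset.sup_mono_fun fun x _ => ?_) (Nat.sub_le_sub_right hst _)
    split_ifs <;> omega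
  let u : ℕ → ℕ := fun r => W 0 + ∑ s ∈ Finset.range r, d (s + γ s)
  have hu : ∀ r, u (r + 1) = u r + d (r + γ r) := fun r => by
    simp only [u, Finset.sum_range_succ, add_assoc]
  let Cross : ℕ → ℕ → Prop := fun r c => (∀ s < r, γ s ≤ c) ∧ ∀ s, r ≤ s → c ≤ γ s
  have hcross : ∀ r c, Cross r c → ∀ r', W (r' + c) + u r ≤ u r' + W (r + c) := by
    intro r c ⟨h1, h2⟩ r'
    rcases le_total r r' with h | h
    · induction r', h using Nat.le_induction with
      | base => omega
      | succ n hn ih =>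
        have h3 := hd (Nat.add_le_add_left (h2 n hn) n)
        rw [hu, show n + 1 + c = n + c + 1 by ring, hW]
        omega
    · induction h using Nat.decreasingInduction with
      | of_succ n hn ih =>
        have h3 := hd (Nat.add_le_add_left (h1 n hn) n)
        rw [hu, show n + 1 + c = n + c + 1 by ring, hW] at ih
        omega
      | self => omega
  have hex : ∀ c, ∃ r, Cross r c := by
    intro c
    have h : ∃ r, c ≤ γ r := ⟨L + c, le_max_of_le_right (by omega)⟩
    refine ⟨Nat.find h, fun s hs => ?_, fun s hs => ?_⟩
    · have := Nat.find_min h hs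
      omega
    · exact (Nat.find_spec h).trans (hγmono hs)
  choose ρ hρ using hex
  have hu0 : ∀ c, u (ρ c) ≤ W (ρ c + c) := fun c => by
    have h1 := hcross _ c (hρ c) 0
    have h2 : W 0 ≤ W (0 + c) :=
      monotone_nat_of_le_succ (fun n => by rw [hW]; omega) (by omega)
    have h3 : u 0 = W 0 := by simp [u]
    omega
  refine ⟨u, fun c => W (ρ c + c) - u (ρ c), fun r c => ?_, fun x hx => ?_⟩
  · have := hcross _ c (hρ c) r
    have := hu0 c
    dsimp only
    omega
  · have hx' : Cross x.1 x.2 := by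
      refine ⟨fun s hs => max_le (Finset.sup_le fun y hy => ?_) ?_, fun s hs => ?_⟩
      · split_ifs with h
        · rcases hC x hx y hy with h' | h'
          · have := h'.1; omega
          · exact h'.2
        · omega
      · have : x.1 ≤ L := Finset.le_sup (f := Prod.fst) hx
        omega
      · refine le_max_of_le_left (le_trans ?_ (Finset.le_sup hx))
        simp [hs]
    have h1 := hcross _ _ hx' (ρ x.2)
    have h2 := hcross _ _ (hρ x.2) x.1
    have := hu0 x.2
    dsimp only
    omega

/-- The order on the variables `x_{ij}^{(k)}` induced by the product order on the universal cover
of a cylinder. -/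
def CylLE {p q : ℕ} (v w : Fin p × Fin q × ℕ) : Prop :=
  v.2.2 + (if w.1 < v.1 then 1 else 0) + (if w.2.1 < v.2.1 then 1 else 0) ≤ w.2.2

theorem CylLE.refl {p q : ℕ} (v : Fin p × Fin q × ℕ) : CylLE v v := by simp [CylLE]

theorem CylLE.trans {p q : ℕ} {u v w : Fin p × Fin q × ℕ} (h : CylLE u v) (h' : CylLE v w) :
    CylLE u w := by
  simp only [CylLE, Fin.lt_def] at *
  split_ifs at * <;> omega

theorem CylLE.antisymm {p q : ℕ} {v w : Fin p × Fin q × ℕ} (h : CylLE v w) (h' : CylLE w v) :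
    v = w := by
  simp only [CylLE, Fin.lt_def] at *
  refine Prod.ext (Fin.ext ?_) (Prod.ext (Fin.ext ?_) ?_) <;> split_ifs at * <;> omega

/-- `CylLE` as a partial order. -/
abbrev cylOrder (p q : ℕ) : PartialOrder (Fin p × Fin q × ℕ) where
  le := CylLE
  lt v w := CylLE v w ∧ ¬ CylLE w v
  lt_iff_le_not_ge _ _ := Iff.rfl
  le_refl := CylLE.refl
  le_trans _ _ _ := CylLE.trans
  le_antisymm _ _ := CylLE.antisymm

theorem exists_cylLE_greatest {p q : ℕ} (C : Finset (Fin p × Fin q × ℕ)) (hne : C.Nonempty)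
    (hC : ∀ x ∈ C, ∀ y ∈ C, CylLE x y ∨ CylLE y x) : ∃ a ∈ C, ∀ x ∈ C, CylLE x a := by
  obtain ⟨a, ha, hamax⟩ :=
    @Finset.exists_maximal _ (cylOrder p q).toLE ⟨fun _ _ _ => CylLE.trans⟩ C hne
  exact ⟨a, ha, fun x hx => (hC x hx a ha).elim id fun h => hamax hx h⟩

/-- A chain on the cylinder lifts to its universal cover. -/
theorem exists_chain_lift {p q : ℕ} (C : Finset (Fin p × Fin q × ℕ))
    (hC : ∀ x ∈ C, ∀ y ∈ C, CylLE x y ∨ CylLE y x) :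
    ∃ A : Fin p × Fin q × ℕ → ℕ, ∀ x ∈ C, A x ≤ x.2.2 ∧ ∀ y ∈ C, CylLE x y →
      A x + (if y.1 < x.1 then 1 else 0) ≤ A y ∧
      x.2.2 - A x + (if y.2.1 < x.2.1 then 1 else 0) ≤ y.2.2 - A y := by
  classical
  induction C using Finset.strongInduction with
  | H C ih =>
  rcases C.eq_empty_or_nonempty with rfl | hne
  · exact ⟨0, by simp⟩
  obtain ⟨a, ha, hatop⟩ := exists_cylLE_greatest C hne hC
  have hC' : ∀ x ∈ C.erase a, ∀ y ∈ C.erase a, CylLE x y ∨ CylLE y x := fun x hx y hy =>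
    hC x (Finset.mem_of_mem_erase hx) y (Finset.mem_of_mem_erase hy)
  obtain ⟨A, hA⟩ := ih (C.erase a) (Finset.erase_ssubset ha) hC'
  rcases (C.erase a).eq_empty_or_nonempty with h0 | hne'
  · have hCa : ∀ x ∈ C, x = a := fun x hx => by
      by_contra h
      have : x ∈ C.erase a := Finset.mem_erase.2 ⟨h, hx⟩
      simp [h0] at this
    refine ⟨0, fun x hx => ⟨Nat.zero_le _, fun y hy _ => ?_⟩⟩
    rw [hCa x hx, hCa y hy]
    simp
  obtain ⟨b, hb, hbtop⟩ := exists_cylLE_greatest _ hne' hC'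
  have hba := hatop b (Finset.mem_of_mem_erase hb)
  have hAb := (hA b hb).1
  refine ⟨fun x => if x = a then A b + (if a.1 < b.1 then 1 else 0) else A x,
    fun x hx => ?_⟩
  by_cases hxa : x = a
  · subst hxa
    simp only [if_true]
    refine ⟨?_, fun y hy hxy => ?_⟩
    · simp only [CylLE] at hba
      omega
    · obtain rfl := hxy.antisymm (hatop y hy)
      simp
  · have hx' : x ∈ C.erase a := Finset.mem_erase.2 ⟨hxa, hx⟩
    simp only [hxa, if_false]
    refine ⟨(hA x hx').1, fun y hy hxy => ?_⟩
    by_cases hya : y = a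
    · subst hya
      have := (hA x hx').2 b hb (hbtop x hx')
      simp only [if_true]
      simp only [CylLE, Fin.lt_def] at *
      split_ifs at * <;> omega
    · have hy' : y ∈ C.erase a := Finset.mem_erase.2 ⟨hya, hy⟩
      simp only [hya, if_false]
      exact (hA x hx').2 y hy' hxy

/-- The Taylor morphism `f ↦ ∑ (∂̄^n f) t^n`. -/
noncomputable def taylorHom (p q : ℕ) : PolyR p q →ₐ[ℤ] PowerSeries (PolyR p q) :=
  aeval fun v => PowerSeries.mk fun n =>
    ((v.2.2 + n).choose n : PolyR p q) * X (v.1, v.2.1, v.2.2 + n)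

theorem derivative_taylorHom (p q : ℕ) (f : PolyR p q) :
    PowerSeries.derivative (PolyR p q) (taylorHom p q f) = taylorHom p q (derivR p q f) := by
  induction f using MvPolynomial.induction_on with
  | C a =>
    rw [show (C a : PolyR p q) = algebraMap ℤ _ a from rfl, AlgHom.commutes,
      Derivation.map_algebraMap, map_zero, IsScalarTower.algebraMap_apply ℤ (PolyR p q),
      Derivation.map_algebraMap]
  | add f g hf hg => simp only [map_add, hf, hg]
  | mul_X f v hf =>
    have hX : PowerSeries.derivative (PolyR p q) (taylorHom p q (X v)) =
        taylorHom p q (derivR p q (X v)) := by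
      obtain ⟨i, j, k⟩ := v
      rw [derivR, mkDerivation_X, map_zsmul]
      ext1 n
      rw [map_zsmul]
      simp only [taylorHom, aeval_X, PowerSeries.coeff_derivative, PowerSeries.coeff_mk,
        zsmul_eq_mul]
      have h1 : (k + 1 + n).choose n * (k + 1) = (k + (n + 1)).choose (n + 1) * (n + 1) := by
        have := Nat.add_one_mul_choose_eq (k + n) n
        have h2 := Nat.choose_succ_right_eq (k + n + 1) n
        rw [show k + 1 + n = k + n + 1 by ring, show k + (n + 1) = k + n + 1 by ring, h2]
        congr 1
        omega
      have h3 := congrArg (Nat.cast : ℕ → PolyR p q) h1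
      push_cast at h3 ⊢
      rw [show k + 1 + n = k + (n + 1) by ring] at h3 ⊢
      linear_combination -(X (i, j, k + (n + 1)) : PolyR p q) * h3
    rw [map_mul, Derivation.leibniz, Derivation.leibniz, map_add, smul_eq_mul, smul_eq_mul,
      smul_eq_mul, smul_eq_mul, map_mul, map_mul, hf, hX]

theorem constantCoeff_taylorHom (p q : ℕ) (f : PolyR p q) :
    PowerSeries.constantCoeff (taylorHom p q f) = f := by
  induction f using MvPolynomial.induction_on with
  | C a =>
    rw [show (C a : PolyR p q) = algebraMap ℤ _ a from rfl, AlgHom.commutes,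
      IsScalarTower.algebraMap_apply ℤ (PolyR p q)]
    exact PowerSeries.constantCoeff_C _
  | add f g hf hg => simp only [map_add, hf, hg]
  | mul_X f v hf =>
    rw [map_mul, map_mul, hf, taylorHom, aeval_X, ← PowerSeries.coeff_zero_eq_constantCoeff_apply,
      PowerSeries.coeff_mk]
    simp

theorem factorial_smul_coeff_taylorHom (p q n : ℕ) (f : PolyR p q) :
    (n.factorial : ℤ) • PowerSeries.coeff n (taylorHom p q f) = (⇑(derivR p q))^[n] f := by
  have h : Function.Semiconj (taylorHom p q) (derivR p q)
      (PowerSeries.derivative (PolyR p q)) := fun f => (derivative_taylorHom p q f).symm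
  have h2 := congrArg PowerSeries.constantCoeff ((h.iterate_right n) f)
  rw [constantCoeff_taylorHom, PowerSeries.constantCoeff_iterate_derivative] at h2
  rw [h2]
  simp

/-- The generic matrix `X(t) = ∑ x^{(k)} t^k`. -/
noncomputable def arcMatrix (p q : ℕ) : Matrix (Fin p) (Fin q) (PowerSeries (PolyR p q)) :=
  Matrix.of fun i j => PowerSeries.mk fun k => X (i, j, k)

theorem taylorHom_det {p q m : ℕ} (u : Fin m → Fin p) (v : Fin m → Fin q) :
    taylorHom p q (Matrix.det (Matrix.of fun a b : Fin m => (X (u a, v b, 0) : PolyR p q))) =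
      ((arcMatrix p q).submatrix u v).det := by
  rw [AlgHom.map_det]
  congr 1
  ext1 a b
  simp [taylorHom, arcMatrix]

theorem eq_coeff_det_iff {p q m n : ℕ} (u : Fin m → Fin p) (v : Fin m → Fin q) (g : PolyR p q) :
    (n.factorial : ℤ) • g = (⇑(derivR p q))^[n]
        (Matrix.det (Matrix.of fun a b : Fin m => (X (u a, v b, 0) : PolyR p q))) ↔
      g = PowerSeries.coeff n ((arcMatrix p q).submatrix u v).det := by
  rw [← factorial_smul_coeff_taylorHom, taylorHom_det]
  exact (smul_right_injective _ (by exact_mod_cast n.factorial_ne_zero)).eq_iff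

theorem coeff_det_mem_minorIdeal {p q m : ℕ} (n : ℕ) {u : Fin m → Fin p} {v : Fin m → Fin q}
    (hu : StrictMono u) (hv : StrictMono v) :
    PowerSeries.coeff n ((arcMatrix p q).submatrix u v).det ∈ minorIdeal p q m :=
  Ideal.subset_span ⟨n, u, v, hu, hv, (eq_coeff_det_iff u v _).2 rfl⟩

theorem det_mul_eq_zero_of_rank_factorization {R : Type*} [CommRing R] {h : ℕ}
    (M : Matrix (Fin (h + 1)) (Fin h) R) (N : Matrix (Fin h) (Fin (h + 1)) R) :
    (M * N).det = 0 := by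
  have : M * N = (Matrix.of fun a b => (Fin.snoc (M a) 0 : Fin (h + 1) → R) b) *
      (Matrix.of fun a b => (Fin.snoc (fun l => N l b) 0 : Fin (h + 1) → R) a) := by
    ext a b
    simp [Matrix.mul_apply, Fin.sum_univ_castSucc]
  rw [this, Matrix.det_mul, Matrix.det_eq_zero_of_column_eq_zero (Fin.last h) (by simp), zero_mul]

/-- The comorphism of `(Y(t), Z(t)) ↦ Y(t) Z(t)` with inner dimension `h`. -/
noncomputable def productHom (p q h : ℕ) :
    PolyR p q →ₐ[ℤ] MvPolynomial ((Fin p × Fin h × ℕ) ⊕ (Fin h × Fin q × ℕ)) ℤ :=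
  aeval fun v => ∑ l, ∑ x ∈ Finset.HasAntidiagonal.antidiagonal v.2.2,
    X (Sum.inl (v.1, l, x.1)) * X (Sum.inr (l, v.2.1, x.2))

theorem minorIdeal_le_ker_productHom (p q h : ℕ) :
    minorIdeal p q (h + 1) ≤ RingHom.ker (productHom p q h) := by
  refine Ideal.span_le.2 ?_
  rintro g ⟨n, u, v, -, -, hg⟩
  rw [(eq_coeff_det_iff u v g).1 hg, SetLike.mem_coe, RingHom.mem_ker]
  let Y : Matrix (Fin (h + 1)) (Fin h)
      (PowerSeries (MvPolynomial ((Fin p × Fin h × ℕ) ⊕ (Fin h × Fin q × ℕ)) ℤ)) :=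
    Matrix.of fun a l => PowerSeries.mk fun k => X (Sum.inl (u a, l, k))
  let Z : Matrix (Fin h) (Fin (h + 1))
      (PowerSeries (MvPolynomial ((Fin p × Fin h × ℕ) ⊕ (Fin h × Fin q × ℕ)) ℤ)) :=
    Matrix.of fun l b => PowerSeries.mk fun k => X (Sum.inr (l, v b, k))
  have key : (PowerSeries.map (productHom p q h).toRingHom).mapMatrix
      ((arcMatrix p q).submatrix u v) = Y * Z := by
    ext1 a b
    ext1 k
    simp [arcMatrix, Matrix.mul_apply, PowerSeries.coeff_mul, productHom, Y, Z]
  have h2 := congrArg (fun M => PowerSeries.coeff n M.det) key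
  simp only [det_mul_eq_zero_of_rank_factorization, ← RingHom.map_det, PowerSeries.coeff_map] at h2
  simpa using h2

/-- Height of the variable `x_{ij}^{(k)}` on the cylinder, an injective function of `(i, j, k)`. -/
def height {p q : ℕ} (v : Fin p × Fin q × ℕ) : ℕ := p * q * v.2.2 + q * v.1 + v.2.1

theorem height_injective (p q : ℕ) : Function.Injective (height (p := p) (q := q)) := by
  rintro ⟨i, j, k⟩ ⟨i', j', k'⟩ h
  simp only [height] at h
  have hq : 0 < q := j.pos
  have hp : 0 < p := i.pos
  have hj : (j : ℕ) = j' := by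
    have := congrArg (· % q) h
    simpa [mul_assoc, mul_left_comm p q, ← mul_add, Nat.mul_add_mod,
      Nat.mod_eq_of_lt j.isLt, Nat.mod_eq_of_lt j'.isLt] using this
  have h2 : p * k + i = p * k' + i' := by
    apply Nat.eq_of_mul_eq_mul_left hq
    rw [hj] at h
    linarith
  have hi : (i : ℕ) = i' := by
    have := congrArg (· % p) h2
    simpa [Nat.mul_add_mod, Nat.mod_eq_of_lt i.isLt, Nat.mod_eq_of_lt i'.isLt] using this
  rw [hi] at h2
  have hk : k = k' := Nat.eq_of_mul_eq_mul_left hp (by omega)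
  rw [Fin.ext hi, Fin.ext hj, hk]

/-- Swapping the columns of two comparable variables in general position lowers the weight. -/
theorem exists_exchange {p q B : ℕ} (hB : 2 ≤ B) {i i' : Fin p} {j j' : Fin q} {k k' : ℕ}
    (hi : i ≠ i') (hj : j ≠ j') (h : CylLE (i, j, k) (i', j', k')) :
    ∃ l l', l + l' = k + k' ∧
      B ^ height (i', j, l) + B ^ height (i, j', l') <
        B ^ height (i, j, k) + B ^ height (i', j', k') := by
  have hi' : (i : ℕ) ≠ i' := Fin.val_ne_of_ne hi
  have hj' : (j : ℕ) ≠ j' := Fin.val_ne_of_ne hj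
  have hp : 0 < p := i.pos
  have hjq := j.isLt
  have hqpq : q ≤ p * q := Nat.le_mul_of_pos_left q hp
  have hipq : q * i < p * q := by
    rw [mul_comm p q]; exact Nat.mul_lt_mul_of_pos_left i.isLt j.pos
  obtain ⟨e, r, hr⟩ : ∃ e, q * (i : ℕ) < p * q * e + q * i' ∧
      k + e + (if j' < j then 1 else 0) ≤ k' := by
    simp only [CylLE] at h
    by_cases hlt : i' < i
    · refine ⟨1, by omega, ?_⟩
      simpa [hlt] using h
    · refine ⟨0, ?_, by simpa [hlt] using h⟩
      rw [Fin.lt_def] at hlt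
      have := Nat.mul_lt_mul_of_pos_left (show (i : ℕ) < i' by omega) j.pos
      omega
  have c : p * q * k + j < p * q * (k' - e) + j' := by
    simp only [Fin.lt_def] at hr
    by_cases hlt : (j' : ℕ) < j
    · have h1 : k + 1 ≤ k' - e := by
        rw [if_pos hlt] at hr; omega
      have := Nat.mul_le_mul_left (p * q) h1
      rw [mul_add] at this
      omega
    · have h1 : k ≤ k' - e := by
        rw [if_neg hlt] at hr; omega
      have := Nat.mul_le_mul_left (p * q) h1
      omega
  have hek : e ≤ k' := by omega
  refine ⟨e + k, k' - e, by omega, ?_⟩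
  have e1 : height (i', j, e + k) = (p * q * e + q * i') + (p * q * k + j) := by
    simp only [height]; ring
  have e2 : height (i, j', k' - e) = q * i + (p * q * (k' - e) + j') := by
    simp only [height]; ring
  have e3 : height (i, j, k) = q * i + (p * q * k + j) := by
    simp only [height]; ring
  have e4 : height (i', j', k') = (p * q * e + q * i') + (p * q * (k' - e) + j') := by
    obtain ⟨t, rfl⟩ := Nat.exists_eq_add_of_le hek
    simp only [height, Nat.add_sub_cancel_left]; ring
  rw [e1, e2, e3, e4]
  have hr' := Nat.pow_lt_pow_right (show 1 < B by omega) r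
  have hc' := Nat.pow_lt_pow_right (show 1 < B by omega) c
  simp only [pow_add B (p * q * e + q * i'), pow_add B (q * i)]
  nlinarith [hr', hc']

section Configurations

variable {p q m : ℕ} (u : Fin m → Fin p) (v : Fin m → Fin q)

/-- The variables of a term of a coefficient of a minor, indexed by the columns. -/
def termVar (σ : Equiv.Perm (Fin m)) (k : Fin m → ℕ) (a : Fin m) : Fin p × Fin q × ℕ :=
  (u (σ a), v a, k a)

/-- The weight of a term of a coefficient of a minor. -/
def termWeight (B : ℕ) (σ : Equiv.Perm (Fin m)) (k : Fin m → ℕ) : ℕ :=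
  ∑ a, B ^ height (termVar u v σ k a)

/-- The variables of a term are pairwise incomparable. -/
def TermAntichain (σ : Equiv.Perm (Fin m)) (k : Fin m → ℕ) : Prop :=
  ∀ a b, CylLE (termVar u v σ k a) (termVar u v σ k b) → a = b

variable {u v}

theorem exists_termWeight_lt (hu : StrictMono u) (hv : StrictMono v) {B : ℕ} (hB : 2 ≤ B)
    {σ : Equiv.Perm (Fin m)} {k : Fin m → ℕ} (h : ¬ TermAntichain u v σ k) :
    ∃ σ' k', ∑ a, k' a = ∑ a, k a ∧ termWeight u v B σ' k' < termWeight u v B σ k := by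
  classical
  simp only [TermAntichain, not_forall] at h
  obtain ⟨a, b, hab, hne⟩ := h
  have hi : u (σ a) ≠ u (σ b) := fun h => hne (σ.injective (hu.injective h))
  have hj : v a ≠ v b := fun h => hne (hv.injective h)
  obtain ⟨l, l', hl, hlt⟩ := exists_exchange hB hi hj hab
  have split : ∀ f : Fin m → ℕ,
      ∑ c, f c = f a + f b + ∑ c ∈ (Finset.univ.erase a).erase b, f c := fun f => by
    rw [← Finset.add_sum_erase _ f (Finset.mem_univ a),
      ← Finset.add_sum_erase _ f (Finset.mem_erase.2 ⟨Ne.symm hne, Finset.mem_univ b⟩), add_assoc]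
  let k' : Fin m → ℕ := fun c => if c = a then l else if c = b then l' else k c
  have hba : b ≠ a := Ne.symm hne
  refine ⟨σ * Equiv.swap a b, k', ?_, ?_⟩
  · rw [split, split k]
    congr 1
    · simpa [k', hba] using hl
    · refine Finset.sum_congr rfl fun c hc => ?_
      simp only [Finset.mem_erase] at hc
      simp [k', hc.1, hc.2.1]
  · rw [termWeight, termWeight, split, split fun c => B ^ height (termVar u v σ k c)]
    refine add_lt_add_of_lt_of_le ?_ (le_of_eq ?_)
    · simpa [termVar, k', hba] using hlt
    · refine Finset.sum_congr rfl fun c hc => ?_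
      simp only [Finset.mem_erase] at hc
      simp [termVar, k', hc.1, hc.2.1, Equiv.swap_apply_of_ne_of_ne hc.2.1 hc.1]

theorem TermAntichain.spec (hu : StrictMono u) (hv : StrictMono v)
    {σ : Equiv.Perm (Fin m)} {k : Fin m → ℕ} (h : TermAntichain u v σ k) {a b : Fin m}
    (hab : a < b) : (σ b < σ a ∧ k a = k b) ∨ (σ a < σ b ∧ k a = k b + 1) := by
  have h1 := mt (h a b) hab.ne
  have h2 := mt (h b a) hab.ne'
  simp only [CylLE, termVar, hu.lt_iff_lt, hv.lt_iff_lt, hab, hab.not_gt, if_true, if_false]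
    at h1 h2
  have h3 : σ a ≠ σ b := fun h => hab.ne (σ.injective h)
  rcases lt_or_gt_of_ne h3 with h3 | h3
  · simp only [h3, h3.not_gt, if_true, if_false] at h1 h2
    right; exact ⟨h3, by omega⟩
  · simp only [h3, h3.not_gt, if_true, if_false] at h1 h2
    left; exact ⟨h3, by omega⟩

theorem TermAntichain.le_of_sum_eq (hu : StrictMono u) (hv : StrictMono v)
    {σ σ' : Equiv.Perm (Fin m)} {k k' : Fin m → ℕ} (h : TermAntichain u v σ k)
    (h' : TermAntichain u v σ' k') (hk : ∑ a, k a = ∑ a, k' a) : k' ≤ k := by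
  by_contra hcon
  simp only [Pi.le_def, not_forall, not_le] at hcon
  obtain ⟨a, ha⟩ := hcon
  have : ∃ b, k' b < k b := by
    by_contra! hb
    exact (Finset.sum_lt_sum (fun c _ => hb c) ⟨a, Finset.mem_univ a, ha⟩).ne hk
  obtain ⟨b, hb⟩ := this
  rcases lt_trichotomy a b with hab | rfl | hab
  · have h1 := h.spec hu hv hab
    have h2 := h'.spec hu hv hab
    omega
  · omega
  · have h1 := h.spec hu hv hab
    have h2 := h'.spec hu hv hab
    omega

theorem TermAntichain.unique (hu : StrictMono u) (hv : StrictMono v)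
    {σ σ' : Equiv.Perm (Fin m)} {k k' : Fin m → ℕ} (h : TermAntichain u v σ k)
    (h' : TermAntichain u v σ' k') (hk : ∑ a, k a = ∑ a, k' a) : σ = σ' ∧ k = k' := by
  obtain rfl : k = k' :=
    le_antisymm (h'.le_of_sum_eq hu hv h hk.symm) (h.le_of_sum_eq hu hv h' hk)
  refine ⟨?_, rfl⟩
  have hmono : StrictMono (σ' ∘ σ.symm) := by
    intro x y hxy
    obtain ⟨a, rfl⟩ := σ.surjective x
    obtain ⟨b, rfl⟩ := σ.surjective y
    simp only [Function.comp, Equiv.symm_apply_apply]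
    rcases lt_trichotomy a b with hab | rfl | hab
    · rcases h.spec hu hv hab with h1 | h1
      · exact absurd h1.1 hxy.not_gt
      · rcases h'.spec hu hv hab with h2 | h2
        · omega
        · exact h2.1
    · exact absurd hxy (lt_irrefl _)
    · rcases h.spec hu hv hab with h1 | h1
      · rcases h'.spec hu hv hab with h2 | h2
        · exact h2.1
        · omega
      · exact absurd h1.1 hxy.not_gt
  have hid : (σ' ∘ σ.symm : Fin m → Fin m) = id :=
    (hmono.range_inj strictMono_id).1 (by
      rw [Set.range_id, Set.range_eq_univ]
      exact σ'.surjective.comp σ.symm.surjective)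
  ext1 a
  simpa using (congrFun hid (σ a)).symm

/-- Among the terms of a coefficient of a minor, the antichain has strictly the lowest weight. -/
theorem TermAntichain.weight_lt (hu : StrictMono u) (hv : StrictMono v) {B : ℕ} (hB : 2 ≤ B)
    {σ₀ : Equiv.Perm (Fin m)} {k₀ : Fin m → ℕ} (h₀ : TermAntichain u v σ₀ k₀)
    (σ : Equiv.Perm (Fin m)) (k : Fin m → ℕ) (hk : ∑ a, k a = ∑ a, k₀ a)
    (hne : ¬ (σ = σ₀ ∧ k = k₀)) : termWeight u v B σ₀ k₀ < termWeight u v B σ k := by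
  induction hw : termWeight u v B σ k using Nat.strong_induction_on generalizing σ k with
  | _ w ih =>
  subst hw
  obtain ⟨σ', k', hk', hlt⟩ := exists_termWeight_lt hu hv hB
    fun h => hne (h.unique hu hv h₀ hk)
  by_cases h : σ' = σ₀ ∧ k' = k₀
  · rwa [h.1, h.2] at hlt
  · exact (ih _ hlt σ' k' (hk'.trans hk) h rfl).trans hlt

end Configurations

/-- An antichain of variables is the set of variables of a term of a coefficient of a minor. -/
theorem exists_termAntichain {p q m : ℕ} {S : Finset (Fin p × Fin q × ℕ)} (hcard : S.card = m)
    (hS : ∀ x ∈ S, ∀ y ∈ S, CylLE x y → x = y) :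
    ∃ (u : Fin m → Fin p) (v : Fin m → Fin q) (σ : Equiv.Perm (Fin m)) (k : Fin m → ℕ),
      StrictMono u ∧ StrictMono v ∧ TermAntichain u v σ k ∧
      Function.Injective (termVar u v σ k) ∧ ∀ a, termVar u v σ k a ∈ S := by
  classical
  have hrow : Set.InjOn Prod.fst (S : Set (Fin p × Fin q × ℕ)) := by
    intro x hx y hy hxy
    have h1 := hS x hx y hy
    have h2 := hS y hy x hx
    by_contra hne
    have h1 := mt h1 hne
    have h2 := mt h2 (Ne.symm hne)
    simp only [CylLE, hxy, lt_irrefl, Fin.lt_def] at h1 h2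
    split_ifs at h1 h2 <;> omega
  have hcol : Set.InjOn (fun x : Fin p × Fin q × ℕ => x.2.1) S := by
    intro x hx y hy hxy
    have h1 := hS x hx y hy
    have h2 := hS y hy x hx
    by_contra hne
    have h1 := mt h1 hne
    have h2 := mt h2 (Ne.symm hne)
    dsimp only at hxy
    simp only [CylLE, hxy, lt_irrefl, Fin.lt_def] at h1 h2
    split_ifs at h1 h2 <;> omega
  let u := (S.image Prod.fst).orderEmbOfFin ((Finset.card_image_of_injOn hrow).trans hcard)
  let v := (S.image fun x => x.2.1).orderEmbOfFin ((Finset.card_image_of_injOn hcol).trans hcard)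
  have hs : ∀ a, ∃ s ∈ S, s.2.1 = v a := fun a =>
    Finset.mem_image.1 (Finset.orderEmbOfFin_mem _ _ a)
  choose s hsS hsv using hs
  have hσ : ∀ a, ∃ b, u b = (s a).1 := fun a => by
    have : (s a).1 ∈ Set.range u := by
      rw [Finset.range_orderEmbOfFin]
      exact Finset.mem_coe.2 (Finset.mem_image_of_mem _ (hsS a))
    exact this
  choose σ hσu using hσ
  have hσinj : Function.Injective σ := fun a b hab => by
    have h1 : s a = s b := hrow (hsS a) (hsS b) (by rw [← hσu, ← hσu, hab])
    exact v.injective (by rw [← hsv, ← hsv, h1])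
  let σ' := Equiv.ofBijective σ (Finite.injective_iff_bijective.1 hσinj)
  have hvar : ∀ a, termVar u v σ' (fun a => (s a).2.2) a = s a := fun a =>
    Prod.ext (hσu a) (Prod.ext (hsv a).symm rfl)
  have hsinj : Function.Injective s := fun a b h => v.injective (by rw [← hsv, ← hsv, h])
  refine ⟨u, v, σ', fun a => (s a).2.2, u.strictMono, v.strictMono, fun a b hab => ?_,
    fun a b hab => ?_, fun a => ?_⟩
  · rw [hvar, hvar] at hab
    exact hsinj (hS _ (hsS a) _ (hsS b) hab)
  · rw [hvar, hvar] at hab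
    exact hsinj hab
  · rw [hvar]
    exact hsS a

/-- The exponent of a term of a coefficient of a minor. -/
noncomputable def termExponent {p q m : ℕ} (u : Fin m → Fin p) (v : Fin m → Fin q)
    (σ : Equiv.Perm (Fin m)) (k : Fin m → ℕ) : Fin p × Fin q × ℕ →₀ ℕ :=
  ∑ a, Finsupp.single (termVar u v σ k a) 1

theorem weight_termExponent {p q m : ℕ} {u : Fin m → Fin p} {v : Fin m → Fin q}
    (σ : Equiv.Perm (Fin m)) (k : Fin m → ℕ) (w : Fin p × Fin q × ℕ → ℕ) :
    Finsupp.weight w (termExponent u v σ k) = ∑ a, w (termVar u v σ k a) := by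
  simp [termExponent, Finsupp.weight_single]

theorem coeff_det_arcMatrix {p q m : ℕ} (n : ℕ) (u : Fin m → Fin p) (v : Fin m → Fin q) :
    PowerSeries.coeff n ((arcMatrix p q).submatrix u v).det =
      ∑ x ∈ Finset.univ ×ˢ Finset.finsuppAntidiag (Finset.univ : Finset (Fin m)) n,
        ((Equiv.Perm.sign x.1 : ℤˣ) : ℤ) • monomial (termExponent u v x.1 x.2) (1 : ℤ) := by
  rw [Matrix.det_apply', map_sum, Finset.sum_product]
  refine Finset.sum_congr rfl fun σ _ => ?_
  dsimp only
  rw [← Finset.smul_sum, ← zsmul_eq_mul, map_zsmul, PowerSeries.coeff_prod]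
  congr 1
  refine Finset.sum_congr rfl fun l _ => ?_
  simp only [arcMatrix, Matrix.submatrix_apply, Matrix.of_apply, PowerSeries.coeff_mk,
    termExponent, termVar, monomial_sum_one]
  rfl

/-- A monomial divisible by an antichain of `m` variables is congruent to a combination of monomials
of higher weight modulo the ideal of minors. -/
theorem monomial_mem_sup_of_antichain {p q m B : ℕ} (hB : 2 ≤ B) {e : Fin p × Fin q × ℕ →₀ ℕ}
    {S : Finset (Fin p × Fin q × ℕ)} (hSe : S ⊆ e.support) (hcard : S.card = m)
    (hS : ∀ x ∈ S, ∀ y ∈ S, CylLE x y → x = y) :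
    (monomial e 1 : PolyR p q) ∈ (minorIdeal p q m).restrictScalars ℤ ⊔
      restrictSupport ℤ {e' | e'.degree = e.degree ∧
        Finsupp.weight (fun v => v.2.2) e' = Finsupp.weight (fun v => v.2.2) e ∧
        Finsupp.weight (fun v => B ^ height v) e < Finsupp.weight (fun v => B ^ height v) e'} := by
  classical
  obtain ⟨u, v, σ, k, hu, hv, hanti, hinj, hmem⟩ := exists_termAntichain hcard hS
  have hle : termExponent u v σ k ≤ e := by
    intro x
    rw [termExponent, Finsupp.finsetSum_apply]
    simp only [Finsupp.single_apply]
    rw [Finset.sum_boole, Nat.cast_id]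
    by_cases hx : ∃ a, termVar u v σ k a = x
    · obtain ⟨a, rfl⟩ := hx
      refine le_trans (Finset.card_le_one.2 fun b hb c hc => ?_)
        (Nat.one_le_iff_ne_zero.2 (Finsupp.mem_support_iff.1 (hSe (hmem a))))
      simp only [Finset.mem_filter] at hb hc
      exact hinj (hb.2.trans hc.2.symm)
    · rw [Finset.filter_false_of_mem fun a _ ha => hx ⟨a, ha⟩]
      simp
  obtain ⟨r, rfl⟩ := exists_add_of_le hle
  let T := (Finset.univ : Finset (Equiv.Perm (Fin m))) ×ˢ
    Finset.finsuppAntidiag (Finset.univ : Finset (Fin m)) (∑ a, k a)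
  let x₀ : Equiv.Perm (Fin m) × (Fin m →₀ ℕ) := (σ, Finsupp.equivFunOnFinite.symm k)
  have hx₀ : x₀ ∈ T := by simp [T, x₀]
  have hI : (monomial r 1 : PolyR p q) *
      PowerSeries.coeff (∑ a, k a) ((arcMatrix p q).submatrix u v).det ∈
        (minorIdeal p q m).restrictScalars ℤ :=
    Ideal.mul_mem_left _ _ (coeff_det_mem_minorIdeal _ hu hv)
  have hs : ((Equiv.Perm.sign σ : ℤˣ) : ℤ) * ((Equiv.Perm.sign σ : ℤˣ) : ℤ) = 1 := by
    rw [← Units.val_mul, Int.units_mul_self, Units.val_one]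
  rw [coeff_det_arcMatrix, ← Finset.add_sum_erase T _ hx₀, mul_add, Finset.mul_sum] at hI
  have hI' := Submodule.smul_mem _ ((Equiv.Perm.sign σ : ℤˣ) : ℤ) hI
  rw [smul_add, mul_smul_comm, smul_smul, hs, one_smul, monomial_mul, one_mul] at hI'
  have hx₀' : termExponent u v x₀.1 x₀.2 = termExponent u v σ k := rfl
  rw [hx₀', add_comm r] at hI'
  rw [← add_sub_cancel_right (monomial (termExponent u v σ k + r) 1) (((Equiv.Perm.sign σ : ℤˣ) : ℤ) •
    ∑ x ∈ T.erase x₀, monomial r 1 *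
        ((Equiv.Perm.sign x.1 : ℤˣ) : ℤ) • monomial (termExponent u v x.1 x.2) (1 : ℤ))]
  refine Submodule.sub_mem _ (Submodule.mem_sup_left hI') (Submodule.mem_sup_right ?_)
  refine Submodule.smul_mem _ _ (Submodule.sum_mem _ fun x hx => ?_)
  rw [mul_smul_comm, monomial_mul, one_mul]
  refine Submodule.smul_mem _ _ ((monomial_mem_restrictSupport ℤ).2 (Or.inl ?_))
  obtain ⟨hne, hxT⟩ := Finset.mem_erase.1 hx
  have hsum : ∑ a, x.2 a = ∑ a, k a := by
    simpa [T] using hxT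
  refine ⟨?_, ?_, ?_⟩
  · simp only [Finsupp.degree_eq_weight_one, map_add, weight_termExponent]
    exact add_comm _ _
  · simp only [map_add, weight_termExponent, termVar, hsum]
    exact add_comm _ _
  · rw [map_add, map_add, weight_termExponent, weight_termExponent, add_comm]
    refine Nat.add_lt_add_left (hanti.weight_lt hu hv hB x.1 x.2 hsum ?_) _
    rintro ⟨h1, h2⟩
    exact hne (Prod.ext h1 (Finsupp.ext fun a => congrFun h2 a))

/-- The support of the exponent contains no antichain of more than `h` variables. -/
def IsStandard {p q : ℕ} (h : ℕ) (e : Fin p × Fin q × ℕ →₀ ℕ) : Prop :=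
  ∀ S ⊆ e.support, (∀ x ∈ S, ∀ y ∈ S, CylLE x y → x = y) → S.card ≤ h

theorem weight_height_le {p q B : ℕ} (hB : 0 < B) (e : Fin p × Fin q × ℕ →₀ ℕ) :
    Finsupp.weight (fun v => B ^ height v) e ≤
      e.degree * B ^ (p * q * Finsupp.weight (fun v => v.2.2) e + q * p + q) := by
  rw [Finsupp.weight_apply, Finsupp.degree_apply, Finset.sum_mul]
  refine Finset.sum_le_sum fun v hv => ?_
  dsimp only
  rw [smul_eq_mul]
  refine Nat.mul_le_mul_left _ (Nat.pow_le_pow_right hB ?_)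
  have hk : v.2.2 ≤ Finsupp.weight (fun v => v.2.2) e :=
    Finsupp.le_weight_of_ne_zero' (fun v : Fin p × Fin q × ℕ => v.2.2)
      (Finsupp.mem_support_iff.1 hv)
  exact Nat.add_le_add (Nat.add_le_add (Nat.mul_le_mul_left _ hk)
    (Nat.mul_le_mul_left _ v.1.isLt.le)) v.2.1.isLt.le

theorem monomial_mem_sup_isStandard {p q : ℕ} (h : ℕ) (e : Fin p × Fin q × ℕ →₀ ℕ) :
    (monomial e 1 : PolyR p q) ∈ (minorIdeal p q (h + 1)).restrictScalars ℤ ⊔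
      restrictSupport ℤ {e' | IsStandard h e' ∧ e'.degree = e.degree} := by
  induction hN : e.degree * 2 ^ (p * q * Finsupp.weight (fun v => v.2.2) e + q * p + q) -
    Finsupp.weight (fun v => 2 ^ height v) e using Nat.strong_induction_on generalizing e with
  | _ N ih =>
  subst hN
  by_cases he : IsStandard h e
  · exact Submodule.mem_sup_right ((monomial_mem_restrictSupport ℤ).2 (Or.inl ⟨he, rfl⟩))
  · simp only [IsStandard, not_forall, not_le] at he
    obtain ⟨S', hS'e, hS', hcard'⟩ := he
    obtain ⟨S, hSS', hcard⟩ := Finset.exists_subset_card_eq (Nat.succ_le_of_lt hcard')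
    have key := monomial_mem_sup_of_antichain le_rfl (hSS'.trans hS'e) hcard
      fun x hx y hy => hS' x (hSS' hx) y (hSS' hy)
    refine sup_le (le_sup_left : (minorIdeal p q (h + 1)).restrictScalars ℤ ≤ _) ?_ key
    rw [restrictSupport_eq_span, Submodule.span_le, Set.image_subset_iff]
    rintro e' ⟨hd, hk, hw⟩
    have hle := weight_height_le two_pos e'
    have := ih _ (by rw [hd, hk] at hle ⊢; omega) e' rfl
    rwa [hd] at this

theorem mem_sup_isStandard {p q : ℕ} (h : ℕ) (f : PolyR p q) :
    f ∈ (minorIdeal p q (h + 1)).restrictScalars ℤ ⊔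
      restrictSupport ℤ {e | IsStandard h e ∧ e.degree ≤ f.totalDegree} := by
  suffices ∑ e ∈ f.support, monomial e (coeff e f) ∈
      (minorIdeal p q (h + 1)).restrictScalars ℤ ⊔
        restrictSupport ℤ {e | IsStandard h e ∧ e.degree ≤ f.totalDegree} by
    rwa [support_sum_monomial_coeff] at this
  refine Submodule.sum_mem _ fun e he => ?_
  rw [← mul_one (coeff e f), ← smul_eq_mul, ← smul_monomial]
  have hle : restrictSupport ℤ {e' : Fin p × Fin q × ℕ →₀ ℕ | IsStandard h e' ∧
      e'.degree = e.degree} ≤ restrictSupport ℤ {e' | IsStandard h e' ∧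
        e'.degree ≤ f.totalDegree} :=
    restrictSupport_mono ℤ fun e' he' => ⟨he'.1, he'.2.trans_le (le_totalDegree he)⟩
  exact Submodule.smul_mem _ _ (sup_le_sup_left hle ((minorIdeal p q (h + 1)).restrictScalars ℤ)
    (monomial_mem_sup_isStandard h e))

theorem eq_of_sum_mul_pow_eq {B : ℕ} (N : ℕ) (c c' : ℕ → ℕ) (hc : ∀ n, c n < B)
    (hc' : ∀ n, c' n < B)
    (h : ∑ n ∈ Finset.range N, c n * B ^ n = ∑ n ∈ Finset.range N, c' n * B ^ n) :
    ∀ n < N, c n = c' n := by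
  induction N generalizing c c' with
  | zero => simp
  | succ N ih =>
    have hB : 0 < B := (Nat.zero_le _).trans_lt (hc 0)
    have shift : ∀ c : ℕ → ℕ, ∑ n ∈ Finset.range (N + 1), c n * B ^ n =
        B * ∑ n ∈ Finset.range N, c (n + 1) * B ^ n + c 0 := fun c => by
      rw [Finset.sum_range_succ', Finset.mul_sum, pow_zero, mul_one]
      congr 1
      exact Finset.sum_congr rfl fun n _ => by ring
    rw [shift, shift] at h
    have h0 : c 0 = c' 0 := by
      simpa [Nat.mul_add_mod, Nat.mod_eq_of_lt (hc 0), Nat.mod_eq_of_lt (hc' 0)] using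
        congrArg (· % B) h
    rw [h0, Nat.add_right_cancel_iff, Nat.mul_left_cancel_iff hB] at h
    rintro (_ | n) hn
    · exact h0
    · exact ih _ _ (fun n => hc _) (fun n => hc' _) h n (by omega)

theorem eq_of_weight_pow_height_eq {p q B : ℕ} {e e' : Fin p × Fin q × ℕ →₀ ℕ}
    (he : e.degree < B) (he' : e'.degree < B)
    (h : Finsupp.weight (fun v => B ^ height v) e = Finsupp.weight (fun v => B ^ height v) e') :
    e = e' := by
  refine Finsupp.mapDomain_injective (height_injective p q) ?_
  have hlt : ∀ e : Fin p × Fin q × ℕ →₀ ℕ, e.degree < B → ∀ n, e.mapDomain height n < B :=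
    fun e he n => (Finsupp.le_degree n _).trans_lt (by rwa [Finsupp.degree_mapDomain])
  have hsum : ∀ (N : ℕ) (e : Fin p × Fin q × ℕ →₀ ℕ),
      (e.mapDomain height).support ⊆ Finset.range N →
      ∑ n ∈ Finset.range N, e.mapDomain height n * B ^ n =
        Finsupp.weight (fun v => B ^ height v) e := fun N e hN => by
    rw [← Finsupp.sum_of_support_subset (e.mapDomain height) hN (fun n a => a * B ^ n) (by simp),
      Finsupp.sum_mapDomain_index (by simp) (by simp [add_mul]), Finsupp.weight_apply]
    rfl
  obtain ⟨N, hN⟩ := Finset.exists_nat_subset_range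
    ((e.mapDomain height).support ∪ (e'.mapDomain height).support)
  have key := eq_of_sum_mul_pow_eq N _ _ (hlt e he) (hlt e' he') (by
    rw [hsum N e (Finset.subset_union_left.trans hN), hsum N e' (Finset.subset_union_right.trans hN),
      h])
  ext n
  by_cases hn : n < N
  · exact key n hn
  · rw [Finsupp.notMem_support_iff.1 fun h =>
        hn (Finset.mem_range.1 (hN (Finset.subset_union_left h))),
      Finsupp.notMem_support_iff.1 fun h =>
        hn (Finset.mem_range.1 (hN (Finset.subset_union_right h)))]

/-- Tropical rank-one matrices dominating the weights, with equality along a chain of variables. -/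
theorem exists_rankOne_bound {p q B : ℕ} (hB : 0 < B) (C : Finset (Fin p × Fin q × ℕ))
    (hC : ∀ x ∈ C, ∀ y ∈ C, CylLE x y ∨ CylLE y x) :
    ∃ (y : Fin p → ℕ → ℕ) (z : Fin q → ℕ → ℕ),
      (∀ i j s t, B ^ height (i, j, s + t) ≤ y i s + z j t) ∧
      ∀ v ∈ C, ∃ s t, s + t = v.2.2 ∧ B ^ height v = y v.1 s + z v.2.1 t := by
  classical
  obtain ⟨A, hA⟩ := exists_chain_lift C hC
  let P : Fin p × Fin q × ℕ → ℕ × ℕ := fun v =>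
    (p * q * A v + q * v.1, p * q * (v.2.2 - A v) + v.2.1)
  have hP : ∀ v ∈ C, ∀ w ∈ C, CylLE v w → P v ≤ P w := by
    intro v hv w hw hvw
    obtain ⟨h1, h2⟩ := (hA v hv).2 w hw hvw
    have hq : v.2.1 < p * q := v.2.1.isLt.trans_le (Nat.le_mul_of_pos_left q v.1.pos)
    have hp : q * v.1 ≤ p * q := by
      rw [mul_comm p q]; exact Nat.mul_le_mul_left _ v.1.isLt.le
    simp only [Fin.lt_def] at h1 h2
    constructor
    · have h3 := Nat.mul_le_mul_left (p * q) h1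
      by_cases hlt : (w.1 : ℕ) < v.1
      · rw [if_pos hlt, mul_add] at h3
        simp only [P]; omega
      · rw [if_neg hlt, add_zero] at h3
        have := Nat.mul_le_mul_left q (not_lt.1 hlt)
        simp only [P]; omega
    · have h3 := Nat.mul_le_mul_left (p * q) h2
      by_cases hlt : (w.2.1 : ℕ) < v.2.1
      · rw [if_pos hlt, mul_add] at h3
        simp only [P]; omega
      · rw [if_neg hlt, add_zero] at h3
        simp only [P]; omega
  obtain ⟨u, w, hle, heq⟩ := exists_potentials (fun n => B ^ n) (fun n => B ^ n * (B - 1))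
    (fun n => by
      obtain ⟨b, rfl⟩ := Nat.exists_eq_succ_of_ne_zero hB.ne'
      simp only [Nat.succ_eq_add_one, Nat.add_sub_cancel]; ring)
    (fun a b hab => Nat.mul_le_mul_right _ (Nat.pow_le_pow_right hB hab)) (C.image P) (by
      simp only [Finset.mem_image]
      rintro _ ⟨v, hv, rfl⟩ _ ⟨w, hw, rfl⟩
      exact (hC v hv w hw).imp (hP v hv w hw) (hP w hw v hv))
  refine ⟨fun i s => u (p * q * s + q * i), fun j t => w (p * q * t + j), fun i j s t => ?_,
    fun v hv => ⟨A v, v.2.2 - A v, Nat.add_sub_cancel' (hA v hv).1, ?_⟩⟩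
  · refine le_of_eq_of_le ?_ (hle _ _)
    congr 1
    simp only [height]; ring
  · have := heq _ (Finset.mem_image_of_mem P hv)
    refine Eq.trans ?_ this
    congr 1
    obtain ⟨t, ht⟩ := Nat.exists_eq_add_of_le (hA v hv).1
    simp only [P, height, ht, Nat.add_sub_cancel_left]; ring

/-- A point of the image of the product map whose tropicalization is the vector of weights, with
nonzero leading coefficients at the variables of a standard monomial. -/
theorem exists_tropical_point {p q h B : ℕ} (hB : 0 < B) {e : Fin p × Fin q × ℕ →₀ ℕ}
    (he : IsStandard h e) :
    ∃ (ψ : MvPolynomial ((Fin p × Fin h × ℕ) ⊕ (Fin h × Fin q × ℕ)) ℤ →ₐ[ℤ] Polynomial ℤ)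
      (a : Fin p × Fin q × ℕ → Polynomial ℤ),
      (∀ v, ψ (productHom p q h (X v)) = Polynomial.X ^ B ^ height v * a v) ∧
      ∀ v ∈ e.support, (a v).coeff 0 ≠ 0 := by
  classical
  obtain ⟨c, hc, hchain⟩ := @exists_chain_coloring _ (cylOrder p q) e.support h he
  have hrank := fun l : Fin h => exists_rankOne_bound hB (e.support.filter fun v => c v = l)
    fun x hx y hy => by
      simp only [Finset.mem_filter] at hx hy
      exact hchain x hx.1 y hy.1 (hx.2.trans hy.2.symm)
  choose y z hle heq using hrank
  refine ⟨aeval (Sum.elim (fun x => Polynomial.X ^ y x.2.1 x.1 x.2.2)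
    fun x => Polynomial.X ^ z x.1 x.2.1 x.2.2), fun v => ∑ l : Fin h,
      ∑ x ∈ Finset.HasAntidiagonal.antidiagonal v.2.2,
        Polynomial.X ^ (y l v.1 x.1 + z l v.2.1 x.2 - B ^ height v), fun v => ?_, fun v hv => ?_⟩
  · simp only [productHom, aeval_X, map_sum, map_mul, Sum.elim_inl, Sum.elim_inr, Finset.mul_sum]
    refine Finset.sum_congr rfl fun l _ => Finset.sum_congr rfl fun x hx => ?_
    have := hle l v.1 v.2.1 x.1 x.2
    rw [Finset.HasAntidiagonal.mem_antidiagonal.1 hx] at this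
    rw [← pow_add, ← pow_add, Nat.add_sub_cancel' this]
  · obtain ⟨s, t, hst, hs⟩ := heq ⟨c v, hc v hv⟩ v (Finset.mem_filter.2 ⟨hv, rfl⟩)
    have hnn : ∀ n : ℕ, (0 : ℤ) ≤ (Polynomial.X ^ n : Polynomial ℤ).coeff 0 := fun n => by
      rw [Polynomial.coeff_X_pow]; split_ifs <;> simp
    simp only [Polynomial.finsetSum_coeff]
    refine ne_of_gt (Finset.sum_pos' (fun l _ => Finset.sum_nonneg fun x _ => hnn _)
      ⟨(⟨c v, hc v hv⟩ : Fin h), Finset.mem_univ _, Finset.sum_pos' (fun x _ => hnn _)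
        ⟨(s, t), Finset.HasAntidiagonal.mem_antidiagonal.2 hst, ?_⟩⟩)
    rw [hs]
    simp

theorem eq_zero_of_productHom_eq_zero {p q h B : ℕ} {g : PolyR p q}
    (hst : ∀ e ∈ g.support, IsStandard h e) (hdeg : ∀ e ∈ g.support, e.degree < B)
    (hg : productHom p q h g = 0) : g = 0 := by
  classical
  by_contra hne
  obtain ⟨e, he, hmin⟩ := Finset.exists_min_image g.support
    (fun e => Finsupp.weight (fun v => B ^ height v) e) (support_nonempty.2 hne)
  obtain ⟨ψ, a, hψ, ha⟩ :=
    exists_tropical_point ((Nat.zero_le _).trans_lt (hdeg e he)) (hst e he)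
  have hcomp : ψ.comp (productHom p q h) =
      aeval fun v => Polynomial.X ^ B ^ height v * a v := by
    ext1 v
    simp [hψ]
  have h0 : aeval (fun v => Polynomial.X ^ B ^ height v * a v) g = 0 := by
    rw [← hcomp, AlgHom.comp_apply, hg, map_zero]
  rw [aeval_def, eval₂_eq] at h0
  have hterm : ∀ d : Fin p × Fin q × ℕ →₀ ℕ,
      algebraMap ℤ (Polynomial ℤ) (coeff d g) *
          ∏ v ∈ d.support, (Polynomial.X ^ B ^ height v * a v) ^ d v =
        Polynomial.X ^ Finsupp.weight (fun v => B ^ height v) d *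
          (Polynomial.C (coeff d g) * ∏ v ∈ d.support, a v ^ d v) := fun d => by
    simp only [mul_pow, Finset.prod_mul_distrib, ← pow_mul, Finset.prod_pow_eq_pow_sum]
    rw [Finsupp.weight_apply, Finsupp.sum]
    simp only [smul_eq_mul, mul_comm (d _)]
    rw [mul_left_comm]
    rfl
  have h1 := congrArg (fun P => P.coeff (Finsupp.weight (fun v => B ^ height v) e)) h0
  simp only [hterm, Polynomial.finsetSum_coeff, Polynomial.coeff_X_pow_mul',
    Polynomial.coeff_zero] at h1
  rw [Finset.sum_eq_single_of_mem e he] at h1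
  · rw [if_pos le_rfl, Nat.sub_self, Polynomial.mul_coeff_zero, Polynomial.coeff_C_zero,
      Polynomial.coeff_zero_prod] at h1
    refine mul_ne_zero (mem_support_iff.1 he) (Finset.prod_ne_zero_iff.2 fun v hv => ?_) h1
    rw [Polynomial.coeff_zero_eq_eval_zero, Polynomial.eval_pow,
      ← Polynomial.coeff_zero_eq_eval_zero]
    exact pow_ne_zero _ (ha v hv)
  · intro d hd hde
    exact if_neg fun hle => hde
      (eq_of_weight_pow_height_eq (hdeg d hd) (hdeg e he) (le_antisymm hle (hmin d hd)))

/-- Second fundamental theorem for arcs: the minors and their derivatives generate the kernel of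
the comorphism of the product map. -/
theorem minorIdeal_eq_ker_productHom (p q h : ℕ) :
    minorIdeal p q (h + 1) = RingHom.ker (productHom p q h) := by
  refine le_antisymm (minorIdeal_le_ker_productHom p q h) fun f hf => ?_
  obtain ⟨a, ha, g, hg, rfl⟩ := Submodule.mem_sup.1 (mem_sup_isStandard h f)
  have hg0 : productHom p q h g = 0 := by
    have h1 : productHom p q h a = 0 := minorIdeal_le_ker_productHom p q h ha
    rwa [RingHom.mem_ker, map_add, h1, zero_add] at hf
  have hg' : g = 0 := eq_zero_of_productHom_eq_zero (g := g) (B := (a + g).totalDegree + 1)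
    (fun e he => (hg he).1) (fun e he => Nat.lt_succ_of_le (hg he).2) hg0
  rw [hg', add_zero]
  exact ha

/-- `𝔯_h = ℤ[x_{ij}^{(k)}]/𝔯[h+1]` is an integral domain. -/
theorem minorQuotient_isDomain (p q h : ℕ) :
    IsDomain (PolyR p q ⧸ minorIdeal p q (h + 1)) := by
  rw [minorIdeal_eq_ker_productHom]
  have := RingHom.ker_isPrime (productHom p q h)
  exact Ideal.Quotient.isDomain _
end

section
/- (Lemma 6.1) Let S = {1,…,s} and for l ∈ S let ∂_l be the derivation on ℤ[x_{ij}^{(k)} : i,j ∈ S, k ≥ 0] with ∂_l x_{ij}^{(k)} = δ_i^l (k+1) x_{ij}^{(k+1)}, and for N ⊂ S let ∂̄_N^l = (1/l!)(Σ_{i∈N} ∂_i)^l. For subsets I, K, L ⊂ S with L ⊂ I, |K| = |I| = k, and |L| ≤ n ≤ |I|, if l < 2n − |L|, then Σ_{L ⊂ N ⊂ I, |N| = n} ∂̄_N^l 𝒜(I,K) lies in the ideal 𝔯[k−n+1] generated by all (k−n+1)-minors and their normalized derivatives. -/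
open MvPolynomial

/-- `ℤ[x_{ij}^{(k)} : i,j ∈ S = {1,…,s}, k ≥ 0]`. -/
abbrev PolyS (s : ℕ) := MvPolynomial (Fin s × Fin s × ℕ) ℤ

/-- The full derivation `∂` with `∂x_{ij}^{(k)} = (k+1)x_{ij}^{(k+1)}`. -/
noncomputable def dFull (s : ℕ) : Derivation ℤ (PolyS s) (PolyS s) :=
  mkDerivation ℤ fun v => ((v.2.2 : ℤ) + 1) • X (v.1, v.2.1, v.2.2 + 1)

/-- The row derivation `∂_l`, acting only on row `l`:
`∂_l x_{ij}^{(k)} = δ_i^l (k+1) x_{ij}^{(k+1)}`. -/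
noncomputable def dRow (s : ℕ) (l : Fin s) : Derivation ℤ (PolyS s) (PolyS s) :=
  mkDerivation ℤ fun v =>
    if v.1 = l then ((v.2.2 : ℤ) + 1) • X (v.1, v.2.1, v.2.2 + 1) else 0

/-- The column derivation `(∂_*)_l`, acting only on column `l`. -/
noncomputable def dCol (s : ℕ) (l : Fin s) : Derivation ℤ (PolyS s) (PolyS s) :=
  mkDerivation ℤ fun v =>
    if v.2.1 = l then ((v.2.2 : ℤ) + 1) • X (v.1, v.2.1, v.2.2 + 1) else 0

/-- `∂_N = Σ_{l ∈ N} ∂_l`. -/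
noncomputable def dRowSet (s : ℕ) (N : Finset (Fin s)) :
    Derivation ℤ (PolyS s) (PolyS s) :=
  ∑ l ∈ N, dRow s l

/-- `(∂_*)_N = Σ_{l ∈ N} (∂_*)_l`. -/
noncomputable def dColSet (s : ℕ) (N : Finset (Fin s)) :
    Derivation ℤ (PolyS s) (PolyS s) :=
  ∑ l ∈ N, dCol s l

/-- The minor `𝒜(I,K) = det (x_{ij}^{(0)})_{i∈I, j∈K}`, rows and columns taken in
increasing order (and `0` if `|I| ≠ |K|`). -/
noncomputable def minorA (s : ℕ) (I K : Finset (Fin s)) : PolyS s :=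
  if h : K.card = I.card then
    (Matrix.of fun a b : Fin I.card =>
      (X ((I.orderIsoOfFin rfl a : Fin s), (K.orderIsoOfFin h b : Fin s), 0) :
        PolyS s)).det
  else 0

/-- `ε(I,K) = (−1)^{Σ_{i∈I} i + Σ_{j∈K} j}` (indices counted `1,…,s`). -/
def epsSign (s : ℕ) (I K : Finset (Fin s)) : ℤ :=
  (-1) ^ (∑ i ∈ I, ((i : ℕ) + 1) + ∑ j ∈ K, ((j : ℕ) + 1))

/-- The ideal `𝔯[m]` generated by all `m`-minors and their normalized derivatives
(characterized by `n! • g = ∂^n 𝒜(I,K)`). -/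
noncomputable def minorIdealS (s m : ℕ) : Ideal (PolyS s) :=
  Ideal.span {g | ∃ (n : ℕ) (I K : Finset (Fin s)), I.card = m ∧ K.card = m ∧
    (n.factorial : ℤ) • g = (⇑(dFull s))^[n] (minorA s I K)}

/-- All minors of size `m` of `M` vanish. Rows and columns are picked by arbitrary functions. -/
def MinorsVanish {ι κ A : Type*} [CommRing A] (m : ℕ) (M : Matrix ι κ A) : Prop :=
  ∀ (e : Fin m → ι) (f : Fin m → κ), (M.submatrix e f).det = 0

/-- The matrix whose rows in `N` come from `P` and whose other rows come from `Q`. -/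
def rowMix {ι κ A : Type*} [DecidableEq ι] (N : Finset ι) (P Q : Matrix ι κ A) : Matrix ι κ A :=
  Matrix.of fun i j => if i ∈ N then P i j else Q i j

theorem MinorsVanish.map {ι κ A B : Type*} [CommRing A] [CommRing B] {m : ℕ} {M : Matrix ι κ A}
    (h : MinorsVanish m M) (φ : A →+* B) : MinorsVanish m (M.map φ) := fun e f => by
  have := congrArg φ (h e f)
  rwa [map_zero, RingHom.map_det] at this

theorem MinorsVanish.submatrix {ι κ ι' κ' A : Type*} [CommRing A] {m : ℕ} {M : Matrix ι κ A}
    (h : MinorsVanish m M) (r : ι' → ι) (c : κ' → κ) : MinorsVanish m (M.submatrix r c) :=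
  fun e f => by simpa using h (r ∘ e) (c ∘ f)

theorem rowMix_map {ι κ A B : Type*} [DecidableEq ι] (N : Finset ι) (P Q : Matrix ι κ A)
    (φ : A → B) : (rowMix N P Q).map φ = rowMix N (P.map φ) (Q.map φ) := by
  ext i j
  simp [rowMix, apply_ite φ]

/-- A determinant vanishes if all minors of size `m` of a set of at least `m` rows vanish. -/
theorem det_eq_zero_of_minors_eq_zero {A : Type*} [CommRing A] {m k : ℕ}
    (M : Matrix (Fin k) (Fin k) A) (T : Finset (Fin k)) (hT : m ≤ T.card)
    (h : ∀ (e f : Fin m → Fin k), (∀ i, e i ∈ T) → (M.submatrix e f).det = 0) : M.det = 0 := by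
  induction k with
  | zero =>
    obtain rfl : m = 0 := by simpa using hT.trans (Finset.card_le_univ T)
    simpa using h id id fun i => i.elim0
  | succ k ih =>
    have hmk : m ≤ k + 1 := by simpa using hT.trans (Finset.card_le_univ T)
    rcases hmk.eq_or_lt with rfl | hm
    · have hTu : T = Finset.univ := by
        rw [← Finset.card_eq_iff_eq_univ]
        exact le_antisymm (Finset.card_le_univ T) (by simpa using hT)
      simpa using h id id (by simp [hTu])
    · obtain ⟨i, hi⟩ : ∃ i, m ≤ (T.erase i).card := by
        by_cases hTu : T = Finset.univ
        · exact ⟨0, by rw [hTu, Finset.card_erase_of_mem (Finset.mem_univ _)]; simp; omega⟩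
        · obtain ⟨i, hi⟩ : ∃ i, i ∉ T := by
            by_contra! hall
            exact hTu (Finset.eq_univ_iff_forall.mpr hall)
          exact ⟨i, by rwa [Finset.erase_eq_of_notMem hi]⟩
      rw [Matrix.det_succ_row M i]
      refine Finset.sum_eq_zero fun j _ => ?_
      rw [ih (M.submatrix i.succAbove j.succAbove)
        (Finset.univ.filter fun x => i.succAbove x ∈ T), mul_zero]
      · refine hi.trans ?_
        have : T.erase i ⊆
            (Finset.univ.filter fun x => i.succAbove x ∈ T).image i.succAbove := by
          intro x hx
          obtain ⟨hxi, hxT⟩ := Finset.mem_erase.mp hx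
          obtain ⟨y, rfl⟩ := Fin.exists_succAbove_eq hxi
          exact Finset.mem_image_of_mem _ (by simpa using hxT)
        exact (Finset.card_le_card this).trans Finset.card_image_le
      · intro e f he
        rw [Matrix.submatrix_submatrix]
        exact h _ _ fun x => by simpa using he x

theorem det_rowMix_eq_zero {A : Type*} [CommRing A] {m k : ℕ} {a : Matrix (Fin k) (Fin k) A}
    (ha : MinorsVanish m a) (Y : Matrix (Fin k) (Fin k) A) {N : Finset (Fin k)}
    (hN : m + N.card ≤ k) : (rowMix N Y a).det = 0 := by
  refine det_eq_zero_of_minors_eq_zero (m := m) _ Nᶜ ?_ fun e f he => ?_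
  · rw [Finset.card_compl, Fintype.card_fin]
    omega
  · rw [← ha e f]
    congr 1
    ext i j
    simp [rowMix, Finset.mem_compl.mp (he i)]

theorem det_rowMix_add_smul {A : Type*} [CommRing A] {k : ℕ} (L : Finset (Fin k))
    (a Y : Matrix (Fin k) (Fin k) A) (v : A) :
    (rowMix L Y (a + v • Y)).det =
      ∑ W ∈ Finset.univ.filter (fun W => L ⊆ W), v ^ (W.card - L.card) * (rowMix W Y a).det := by
  have key := (Matrix.detRowAlternating (n := Fin k) (R := A)).toMultilinearMap.map_add_univ
    (rowMix L Y (v • Y)) (rowMix L 0 a)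
  have hsum : rowMix L Y (v • Y) + rowMix L 0 a = rowMix L Y (a + v • Y) := by
    ext i j
    by_cases hi : i ∈ L <;> simp [rowMix, hi, add_comm]
  rw [← hsum]
  refine key.trans ?_
  rw [Finset.sum_filter]
  refine Finset.sum_congr rfl fun W _ => ?_
  split_ifs with hW
  · rw [← Finset.card_sdiff_of_subset hW]
    have : v ^ (W \ L).card = ∏ i, if i ∈ W \ L then v else 1 := by
      rw [Finset.prod_ite_mem, Finset.univ_inter, Finset.prod_const]
    rw [this, ← Matrix.det_mul_column]
    change Matrix.det _ = _
    congr 1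
    ext i j
    by_cases hiW : i ∈ W <;> by_cases hiL : i ∈ L
    · simp [rowMix, Finset.piecewise, hiW, hiL]
    · simp [rowMix, Finset.piecewise, hiW, hiL]
    · exact absurd (hW hiL) hiW
    · simp [rowMix, Finset.piecewise, hiW, hiL]
  · obtain ⟨i, hiL, hiW⟩ := Finset.not_subset.mp hW
    change Matrix.det _ = _
    exact Matrix.det_eq_zero_of_row_eq_zero i fun j => by
      simp [rowMix, Finset.piecewise, hiW, hiL]

/-- If the minors of size `k - n + 1` of `a` vanish, at least `n` rows of `a` have to be replaced
in a non-zero determinant. -/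
theorem det_rowMix_add_smul_self {A : Type*} [CommRing A] {k n : ℕ} (hnk : n ≤ k)
    {a : Matrix (Fin k) (Fin k) A} (ha : MinorsVanish (k - n + 1) a)
    (Y : Matrix (Fin k) (Fin k) A) (t : A) {N : Finset (Fin k)} (hN : N.card = n) :
    (rowMix N (a + t • Y) a).det = t ^ n * (rowMix N Y a).det := by
  have hmix : rowMix N (a + t • Y) a = rowMix ∅ (rowMix N Y 0) (a + t • rowMix N Y 0) := by
    ext i j
    by_cases hi : i ∈ N <;> simp [rowMix, hi]
  rw [hmix, det_rowMix_add_smul, Finset.sum_eq_single N]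
  · have : rowMix N (rowMix N Y 0) a = rowMix N Y a := by
      ext i j
      by_cases hi : i ∈ N <;> simp [rowMix, hi]
    simp [this, hN]
  · intro W _ hWN
    by_cases hsub : W ⊆ N
    · have := Finset.card_lt_card (hsub.ssubset_of_ne hWN)
      rw [det_rowMix_eq_zero ha _ (by omega), mul_zero]
    · obtain ⟨i, hiW, hiN⟩ := Finset.not_subset.mp hsub
      rw [Matrix.det_eq_zero_of_row_eq_zero i fun j => by simp [rowMix, hiW, hiN], mul_zero]
  · simp

theorem pow_dvd_det_rowMix_add_smul {A : Type*} [CommRing A] {k n : ℕ} (hnk : n ≤ k)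
    {a : Matrix (Fin k) (Fin k) A} (ha : MinorsVanish (k - n + 1) a)
    (L : Finset (Fin k)) (Y : Matrix (Fin k) (Fin k) A) (v : A) :
    v ^ (n - L.card) ∣ (rowMix L Y (a + v • Y)).det := by
  rw [det_rowMix_add_smul]
  refine Finset.dvd_sum fun W _ => ?_
  by_cases hW : W.card < n
  · rw [det_rowMix_eq_zero ha _ (by omega), mul_zero]
    exact dvd_zero _
  · exact (pow_dvd_pow v (by omega)).mul_right _

theorem Polynomial.X_pow_dvd_of_dvd_mul {A : Type*} [CommRing A] {f r : Polynomial A}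
    (hf : IsLeftRegular (f.coeff 0)) (N : ℕ) (h : Polynomial.X ^ N ∣ f * r) :
    Polynomial.X ^ N ∣ r := by
  induction N with
  | zero => simp
  | succ N ih =>
    obtain ⟨r', rfl⟩ := ih ((pow_dvd_pow _ N.le_succ).trans h)
    obtain ⟨q, hq⟩ := h
    have hq' : f * r' = Polynomial.X * q := by
      have : Polynomial.X ^ N * (f * r') = Polynomial.X ^ N * (Polynomial.X * q) := by
        rw [← mul_left_comm, hq]; ring
      exact (Polynomial.monic_X_pow N).isRegular.left this
    rw [pow_succ]
    refine mul_dvd_mul_left _ (Polynomial.X_dvd_iff.mpr (hf ?_))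
    simpa [Polynomial.mul_coeff_zero] using congrArg (fun p => p.coeff 0) hq'

theorem Polynomial.pow_dvd_coeff {A : Type*} [CommRing A] {t : A} (ht : IsLeftRegular t)
    {p : Polynomial A} {N : ℕ} (h0 : Polynomial.X ^ N ∣ p)
    (h1 : (Polynomial.X - Polynomial.C t) ^ N ∣ p) : t ^ N ∣ p.coeff N := by
  obtain ⟨r, rfl⟩ := h1
  have hreg : IsLeftRegular (((Polynomial.X - Polynomial.C t) ^ N).coeff 0) := by
    rw [Polynomial.coeff_zero_eq_eval_zero]
    simp only [Polynomial.eval_pow, Polynomial.eval_sub, Polynomial.eval_X, Polynomial.eval_C,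
      zero_sub]
    refine IsLeftRegular.pow N fun x y hxy => ht ?_
    simpa using hxy
  obtain ⟨r', rfl⟩ := X_pow_dvd_of_dvd_mul hreg N h0
  rw [mul_left_comm, Polynomial.coeff_X_pow_mul', if_pos le_rfl, Nat.sub_self,
    Polynomial.mul_coeff_zero, Polynomial.coeff_zero_eq_eval_zero]
  simp only [Polynomial.eval_pow, Polynomial.eval_sub, Polynomial.eval_X, Polynomial.eval_C,
    zero_sub]
  rw [neg_pow]
  exact (Dvd.intro_left _ rfl).mul_right _

/-- If the minors of size `k - n + 1` of `a` and of `b = a + t Y` vanish, the sum over all `n`-sets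
`N ⊇ L` of the determinants with the rows `N` of `b` and the other rows of `a` is divisible by
`t ^ (2 n - |L|)`: the polynomial `det (a + v Y)`, with rows `L` replaced by those of `Y`, is
divisible by both `v ^ (n - |L|)` and `(v - t) ^ (n - |L|)`. -/
theorem pow_dvd_sum_det_rowMix {A : Type*} [CommRing A] {k n : ℕ} (hnk : n ≤ k) {t : A}
    (ht : IsLeftRegular t) {a Y : Matrix (Fin k) (Fin k) A} (ha : MinorsVanish (k - n + 1) a)
    (hb : MinorsVanish (k - n + 1) (a + t • Y)) {L : Finset (Fin k)} (hL : L.card ≤ n) :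
    t ^ (2 * n - L.card) ∣
      ∑ N ∈ (Finset.powersetCard n Finset.univ).filter (fun N => L ⊆ N),
        (rowMix N (a + t • Y) a).det := by
  set p : Polynomial A := (rowMix L (Y.map Polynomial.C)
    (a.map Polynomial.C + (Polynomial.X : Polynomial A) • Y.map Polynomial.C)).det with hp
  have h0 : Polynomial.X ^ (n - L.card) ∣ p :=
    pow_dvd_det_rowMix_add_smul hnk (ha.map Polynomial.C) L _ _
  have h1 : (Polynomial.X - Polynomial.C t) ^ (n - L.card) ∣ p := by
    have := pow_dvd_det_rowMix_add_smul hnk (hb.map Polynomial.C) L (Y.map Polynomial.C)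
      (Polynomial.X - Polynomial.C t)
    have hab : (a + t • Y).map Polynomial.C +
        (Polynomial.X - Polynomial.C t) • Y.map Polynomial.C =
        a.map Polynomial.C + (Polynomial.X : Polynomial A) • Y.map Polynomial.C := by
      ext1 i j
      simp only [Matrix.add_apply, Matrix.map_apply, Matrix.smul_apply, smul_eq_mul, map_add,
        map_mul]
      ring
    have hrow : rowMix L (Y.map Polynomial.C) ((a + t • Y).map Polynomial.C +
        (Polynomial.X - Polynomial.C t) • Y.map Polynomial.C) = rowMix L (Y.map Polynomial.C)
        (a.map Polynomial.C + (Polynomial.X : Polynomial A) • Y.map Polynomial.C) := by rw [hab]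
    rwa [hrow] at this
  have hcoeff : p.coeff (n - L.card) =
      ∑ N ∈ (Finset.powersetCard n Finset.univ).filter (fun N => L ⊆ N), (rowMix N Y a).det := by
    rw [hp, det_rowMix_add_smul, Polynomial.finsetSum_coeff]
    have hC (W : Finset (Fin k)) : (rowMix W (Y.map Polynomial.C) (a.map Polynomial.C)).det =
        Polynomial.C (rowMix W Y a).det := by
      rw [← rowMix_map, RingHom.map_det]
      rfl
    simp_rw [hC, Polynomial.coeff_X_pow_mul', Polynomial.coeff_C]
    rw [Finset.sum_filter, Finset.sum_filter, ← Finset.sum_subset (Finset.subset_univ _)]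
    · refine Finset.sum_congr rfl fun W hW => ?_
      simp [(Finset.mem_powersetCard.mp hW).2]
    · intro W _ hW
      have hWn : W.card ≠ n := by simpa [Finset.mem_powersetCard] using hW
      split_ifs with hLW h2 h3
      · have := Finset.card_le_card hLW
        omega
      · rfl
      · rfl
      · rfl
  have hsum : ∑ N ∈ (Finset.powersetCard n Finset.univ).filter (fun N => L ⊆ N),
        (rowMix N (a + t • Y) a).det = t ^ n * p.coeff (n - L.card) := by
    rw [hcoeff, Finset.mul_sum]
    refine Finset.sum_congr rfl fun N hN => ?_
    exact det_rowMix_add_smul_self hnk ha Y t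
      (Finset.mem_powersetCard.mp (Finset.mem_filter.mp hN).1).2
  rw [hsum, show 2 * n - L.card = n + (n - L.card) by omega, pow_add]
  exact mul_dvd_mul_left _ (Polynomial.pow_dvd_coeff ht h0 h1)

theorem minorsVanish_of_strictMono {A : Type*} [CommRing A] {m s s' : ℕ}
    {M : Matrix (Fin s) (Fin s') A}
    (h : ∀ (e : Fin m → Fin s) (f : Fin m → Fin s'), StrictMono e → StrictMono f →
      (M.submatrix e f).det = 0) : MinorsVanish m M := by
  intro e f
  by_cases he : Function.Injective e
  swap
  · obtain ⟨i, j, hij, hne⟩ := Function.not_injective_iff.mp he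
    exact Matrix.det_zero_of_row_eq hne (by ext x; simp [hij])
  by_cases hf : Function.Injective f
  swap
  · obtain ⟨i, j, hij, hne⟩ := Function.not_injective_iff.mp hf
    exact Matrix.det_zero_of_column_eq hne fun x => by simp [hij]
  have key := h (e ∘ Tuple.sort e) (f ∘ Tuple.sort f)
    ((Tuple.monotone_sort e).strictMono_of_injective (he.comp (Equiv.injective _)))
    ((Tuple.monotone_sort f).strictMono_of_injective (hf.comp (Equiv.injective _)))
  have h2 : M.submatrix (e ∘ Tuple.sort e) (f ∘ Tuple.sort f) =
      ((M.submatrix e f).submatrix (Tuple.sort e) id).submatrix id (Tuple.sort f) := rfl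
  rw [h2, Matrix.det_permute', Matrix.det_permute] at key
  rcases Int.units_eq_one_or (Equiv.Perm.sign (Tuple.sort e)) with h3 | h3 <;>
  rcases Int.units_eq_one_or (Equiv.Perm.sign (Tuple.sort f)) with h4 | h4 <;>
  simpa [h3, h4] using key

/-- If `φ` intertwines a derivation `D` with the derivative of power series and lifts the
identity, then `φ f` is the Taylor series `∑ Dᵠ f / q! * tᵠ`. -/
theorem factorial_smul_coeff_eq_iterate {σ : Type*}
    (D : Derivation ℤ (MvPolynomial σ ℤ) (MvPolynomial σ ℤ))
    (φ : MvPolynomial σ ℤ →ₐ[ℤ] PowerSeries (MvPolynomial σ ℤ))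
    (h0 : ∀ v, PowerSeries.constantCoeff (φ (X v)) = X v)
    (h1 : ∀ v, PowerSeries.derivative _ (φ (X v)) = φ (D (X v)))
    (f : MvPolynomial σ ℤ) (q : ℕ) :
    (q.factorial : ℤ) • PowerSeries.coeff q (φ f) = (⇑D)^[q] f := by
  have hconst (f) : PowerSeries.constantCoeff (φ f) = f := by
    induction f using MvPolynomial.induction_on with
    | C a => simp
    | add p q hp hq => simp [hp, hq]
    | mul_X p v hp => simp [hp, h0]
  have hder (f) : PowerSeries.derivative _ (φ f) = φ (D f) := by
    induction f using MvPolynomial.induction_on with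
    | C a => simp
    | add p q hp hq => simp [hp, hq]
    | mul_X p v hp => simp [hp, h1]
  induction q generalizing f with
  | zero => simpa using hconst f
  | succ q ih =>
    rw [Function.iterate_succ_apply, ← ih, ← hder, PowerSeries.coeff_derivative,
      Nat.factorial_succ]
    simp only [zsmul_eq_mul]
    push_cast
    ring

theorem exists_eq_constantCoeff_add_X_smul {ι κ R : Type*} [CommRing R]
    (M : Matrix ι κ (PowerSeries R)) :
    ∃ Y : Matrix ι κ (PowerSeries R),
      M = M.map (PowerSeries.C.comp PowerSeries.constantCoeff) +
        (PowerSeries.X : PowerSeries R) • Y := by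
  refine ⟨Matrix.of fun i j => PowerSeries.mk fun q => PowerSeries.coeff (q + 1) (M i j), ?_⟩
  ext1 i j
  rw [Matrix.add_apply, Matrix.smul_apply, add_comm]
  exact PowerSeries.eq_X_mul_shift_add_const (M i j)

theorem dRowSet_X (s : ℕ) (N : Finset (Fin s)) (v : Fin s × Fin s × ℕ) :
    dRowSet s N (X v) =
      if v.1 ∈ N then ((v.2.2 : ℤ) + 1) • X (v.1, v.2.1, v.2.2 + 1) else 0 := by
  have : dRowSet s N (X v) = ∑ l ∈ N, dRow s l (X v) :=
    map_sum (Pi.evalAddMonoidHom (fun _ : PolyS s => PolyS s) (X v) |>.comp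
      Derivation.coeFnAddMonoidHom) _ _
  rw [this]
  simp only [dRow, mkDerivation_X, Finset.sum_ite_eq]

theorem dFull_eq_dRowSet_univ (s : ℕ) : dFull s = dRowSet s Finset.univ := by
  refine MvPolynomial.derivation_ext fun v => ?_
  rw [dRowSet_X]
  simp [dFull, mkDerivation_X]

/-- The matrix of the power series `x_{ij}(t) = ∑ x_{ij}^{(q)} t^q`. -/
noncomputable def jetMatrix (s : ℕ) : Matrix (Fin s) (Fin s) (PowerSeries (PolyS s)) :=
  Matrix.of fun i j => PowerSeries.mk fun q => X (i, j, q)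

/-- The substitution of Taylor series for the variables in the rows `N`. -/
noncomputable def rowTaylor (s : ℕ) (N : Finset (Fin s)) :
    PolyS s →ₐ[ℤ] PowerSeries (PolyS s) :=
  aeval fun v => if v.1 ∈ N then
    PowerSeries.mk fun q => ((v.2.2 + q).choose q : PolyS s) * X (v.1, v.2.1, v.2.2 + q)
  else PowerSeries.C (X v)

theorem factorial_smul_coeff_rowTaylor (s : ℕ) (N : Finset (Fin s)) (f : PolyS s) (q : ℕ) :
    (q.factorial : ℤ) • PowerSeries.coeff q (rowTaylor s N f) = (⇑(dRowSet s N))^[q] f := by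
  refine factorial_smul_coeff_eq_iterate _ _ (fun v => ?_) (fun v => ?_) f q
  · simp only [rowTaylor, aeval_X]
    split_ifs
    · simp [← PowerSeries.coeff_zero_eq_constantCoeff_apply]
    · simp
  · rw [dRowSet_X]
    split_ifs with hv
    · rw [map_zsmul]
      simp only [rowTaylor, aeval_X, hv, if_true]
      ext1 q
      rw [PowerSeries.coeff_derivative, map_zsmul, PowerSeries.coeff_mk, PowerSeries.coeff_mk,
        zsmul_eq_mul, show v.2.2 + 1 + q = v.2.2 + (q + 1) by ring]
      have h : (v.2.2 + (q + 1)).choose (q + 1) * (q + 1) =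
          (v.2.2 + 1) * (v.2.2 + (q + 1)).choose q := by
        rw [Nat.choose_succ_right_eq, mul_comm]
        congr 1
        omega
      have h' := congrArg (Nat.cast : ℕ → PolyS s) h
      push_cast at h' ⊢
      rw [mul_right_comm, h', mul_assoc]
    · simp [rowTaylor, hv]

theorem minorA_eq (s m : ℕ) {I K : Finset (Fin s)} (hI : I.card = m) (hK : K.card = m) :
    minorA s I K = (Matrix.of fun a b : Fin m =>
      (X (I.orderEmbOfFin hI a, K.orderEmbOfFin hK b, 0) : PolyS s)).det := by
  subst hI
  rw [minorA, dif_pos hK]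
  rfl

theorem rowTaylor_minorA (s m : ℕ) {I K : Finset (Fin s)} (hI : I.card = m) (hK : K.card = m)
    (N : Finset (Fin m)) :
    rowTaylor s (N.map (I.orderEmbOfFin hI).toEmbedding) (minorA s I K) =
      (rowMix N ((jetMatrix s).submatrix (I.orderEmbOfFin hI) (K.orderEmbOfFin hK))
        (((jetMatrix s).map (PowerSeries.C ∘ PowerSeries.constantCoeff)).submatrix
          (I.orderEmbOfFin hI) (K.orderEmbOfFin hK))).det := by
  rw [minorA_eq s m hI hK, AlgHom.map_det]
  congr 1
  ext1 i j
  by_cases hi : i ∈ N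
  · simp [rowTaylor, rowMix, jetMatrix, hi]
  · simp [rowTaylor, rowMix, jetMatrix, hi, ← PowerSeries.coeff_zero_eq_constantCoeff_apply]

theorem coeff_det_jetMatrix_mem (s m : ℕ) (e f : Fin m → Fin s) (he : StrictMono e)
    (hf : StrictMono f) (q : ℕ) :
    PowerSeries.coeff q ((jetMatrix s).submatrix e f).det ∈ minorIdealS s m := by
  have hcard (e : Fin m → Fin s) (he : StrictMono e) : (Finset.univ.image e).card = m := by
    simp [Finset.card_image_of_injective _ he.injective]
  have hemb (e : Fin m → Fin s) (he : StrictMono e) :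
      e = (Finset.univ.image e).orderEmbOfFin (hcard e he) :=
    Finset.orderEmbOfFin_unique _ (by simp) he
  refine Ideal.subset_span ⟨q, Finset.univ.image e, Finset.univ.image f, hcard e he, hcard f hf, ?_⟩
  rw [dFull_eq_dRowSet_univ, ← factorial_smul_coeff_rowTaylor]
  congr 2
  rw [minorA_eq s m (hcard e he) (hcard f hf), AlgHom.map_det, ← hemb e he, ← hemb f hf]
  congr 1
  ext1 i j
  simp [rowTaylor, jetMatrix]

theorem minorsVanish_jetMatrix (s m : ℕ) :
    MinorsVanish m
      ((jetMatrix s).map (PowerSeries.map (Ideal.Quotient.mk (minorIdealS s m)))) := by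
  refine minorsVanish_of_strictMono fun e f he hf => ?_
  have : ((jetMatrix s).map (PowerSeries.map (Ideal.Quotient.mk (minorIdealS s m)))).submatrix e f =
      (PowerSeries.map (Ideal.Quotient.mk (minorIdealS s m))).mapMatrix
        ((jetMatrix s).submatrix e f) := rfl
  rw [this, ← RingHom.map_det]
  ext q
  rw [PowerSeries.coeff_map, map_zero, Ideal.Quotient.eq_zero_iff_mem]
  exact coeff_det_jetMatrix_mem s m e f he hf q

/-- Lemma 6.1: for `L ⊆ I`, `|K| = |I| = k`, `|L| ≤ n ≤ |I|` and `l < 2n − |L|`,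
`Σ_{L ⊆ N ⊆ I, |N| = n} ∂̄_N^l 𝒜(I,K) ∈ 𝔯[k−n+1]` (stated in `l!`-cleared form). -/
theorem rowDerivative_sum_in_minorIdeal (s k n l : ℕ) (I K L : Finset (Fin s))
    (hLI : L ⊆ I) (hI : I.card = k) (hK : K.card = k)
    (hLn : L.card ≤ n) (hnk : n ≤ k) (hl : l + L.card < 2 * n)
    (g : PolyS s)
    (hg : (l.factorial : ℤ) • g =
      ∑ N ∈ (Finset.powersetCard n I).filter (fun N => L ⊆ N),
        (⇑(dRowSet s N))^[l] (minorA s I K)) :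
    g ∈ minorIdealS s (k - n + 1) := by
  set e := I.orderEmbOfFin hI with he
  have hIe : Finset.univ.map e.toEmbedding = I := Finset.map_orderEmbOfFin_univ I hI
  obtain ⟨L', -, rfl⟩ := Finset.subset_map_iff.mp (hIe ▸ hLI)
  rw [Finset.card_map] at hLn hl
  set π := Ideal.Quotient.mk (minorIdealS s (k - n + 1))
  set b := (jetMatrix s).submatrix e (K.orderEmbOfFin hK) with hb
  set a := ((jetMatrix s).map (PowerSeries.C ∘ PowerSeries.constantCoeff)).submatrix e
    (K.orderEmbOfFin hK) with ha
  have hg' : g = ∑ N ∈ (Finset.powersetCard n Finset.univ).filter (fun N => L' ⊆ N),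
      PowerSeries.coeff l (rowMix N b a).det := by
    have hl0 : (l.factorial : ℤ) ≠ 0 := by exact_mod_cast l.factorial_ne_zero
    refine smul_right_injective (PolyS s) hl0 ?_
    change (l.factorial : ℤ) • g = (l.factorial : ℤ) • _
    rw [hg, ← hIe, Finset.powersetCard_map, Finset.filter_map, Finset.sum_map, Finset.smul_sum]
    refine Finset.sum_congr ?_ fun N _ => ?_
    · ext N
      simp [Finset.mapEmbedding_apply]
    · rw [hb, ha, he, ← rowTaylor_minorA s k hI hK, factorial_smul_coeff_rowTaylor, hIe]
      rfl
  have hbV : MinorsVanish (k - n + 1) (b.map (PowerSeries.map π)) :=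
    (minorsVanish_jetMatrix s (k - n + 1)).submatrix e (K.orderEmbOfFin hK)
  have hab : a.map (PowerSeries.map π) =
      (b.map (PowerSeries.map π)).map (PowerSeries.C.comp PowerSeries.constantCoeff) := by
    ext1 i j
    simp only [ha, hb, Matrix.map_apply, Matrix.submatrix_apply, Function.comp_apply,
      PowerSeries.map_C, RingHom.comp_apply, ← PowerSeries.coeff_zero_eq_constantCoeff_apply,
      PowerSeries.coeff_map]
  have haV : MinorsVanish (k - n + 1) (a.map (PowerSeries.map π)) := hab ▸ hbV.map _
  obtain ⟨Y, hbY⟩ := exists_eq_constantCoeff_add_X_smul (b.map (PowerSeries.map π))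
  rw [← hab] at hbY
  have hdvd := pow_dvd_sum_det_rowMix hnk (t := PowerSeries.X)
    (fun _ _ h => PowerSeries.X_mul_cancel h) haV (hbY ▸ hbV) hLn
  rw [← hbY] at hdvd
  have hzero := PowerSeries.X_pow_dvd_iff.mp hdvd l (by omega)
  rw [← Ideal.Quotient.eq_zero_iff_mem, hg', map_sum, ← hzero, map_sum]
  refine Finset.sum_congr rfl fun N _ => ?_
  rw [← PowerSeries.coeff_map, RingHom.map_det, ← rowMix_map]
  rfl
end
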